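/- arXiv:math/9909191 — 2 statements merged into one kernel-verified Lean document; each statement's English description precedes it below -/
import Mathlib

section
/- Let Y be a contractible, locally compact Hadamard space that is a topological n-manifold, and let h : Y → Y be a continuous map such that d(h(y), y) ≤ C for all y and some constant C. Then h is surjective. -/
open Metric Set

section Defs

variable {X : Type*} [MetricSpace X]

/-- `γ` is a unit-speed geodesic on the parameter set `s`. -/
def IsGeodesicOn (γ : ℝ → X) (s : Set ℝ) : Prop :=
  ∀ a ∈ s, ∀ b ∈ s, dist (γ a) (γ b) = |a - b|

/-- `γ` is a unit-speed geodesic segment from `x` to `y`, on `[0, dist x y]`. -/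
def IsGeodesicFromTo (γ : ℝ → X) (x y : X) : Prop :=
  γ 0 = x ∧ γ (dist x y) = y ∧ IsGeodesicOn γ (Set.Icc 0 (dist x y))

/-- A geodesic metric space: any two points are joined by a geodesic segment. -/
def GeodesicSpace (X : Type*) [MetricSpace X] : Prop :=
  ∀ x y : X, ∃ γ : ℝ → X, IsGeodesicFromTo γ x y

/-- A CAT(0) space: a geodesic space in which every geodesic triangle satisfies the
comparison inequality (distance from a vertex to a point on the opposite side is at most
the corresponding distance in a Euclidean comparison triangle). -/
def CAT0 (X : Type*) [MetricSpace X] : Prop :=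
  GeodesicSpace X ∧
    ∀ (x y : X) (γ : ℝ → X), IsGeodesicFromTo γ x y →
      ∀ t ∈ Set.Icc (0:ℝ) 1, ∀ p : X,
        dist p (γ (t * dist x y)) ^ 2 ≤
          (1 - t) * dist p x ^ 2 + t * dist p y ^ 2 - t * (1 - t) * dist x y ^ 2

/-- A Hadamard space: a complete CAT(0) geodesic space. -/
def Hadamard (X : Type*) [MetricSpace X] : Prop := CompleteSpace X ∧ CAT0 X

end Defs

section

open MeasureTheory Filter Topology
/-- A family of functions depending polynomially on a real parameter, with continuous coefficients. -/
def IsPolynomialFamily {X : Type*} [TopologicalSpace X] (F : ℝ → X → ℝ) : Prop :=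
  ∃ p : X → Polynomial ℝ, (∀ k, Continuous fun x => (p x).coeff k) ∧
    (∃ N, ∀ x, (p x).natDegree ≤ N) ∧ ∀ l x, F l x = (p x).eval l

namespace IsPolynomialFamily

variable {X : Type*} [TopologicalSpace X] {F G : ℝ → X → ℝ}

theorem of_continuous {f : X → ℝ} (hf : Continuous f) : IsPolynomialFamily fun _ x => f x := by
  refine ⟨fun x => Polynomial.C (f x), fun k => ?_, ⟨0, by simp⟩, by simp⟩
  simp only [Polynomial.coeff_C]
  split_ifs
  exacts [hf, continuous_const]

theorem param_mul {f : X → ℝ} (hf : Continuous f) : IsPolynomialFamily fun l x => l * f x := by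
  refine ⟨fun x => Polynomial.X * Polynomial.C (f x), fun k => ?_, ⟨1, fun x => ?_⟩,
    fun l x => by rw [Polynomial.eval_mul, Polynomial.eval_X, Polynomial.eval_C]⟩
  · simp only [Polynomial.coeff_mul_C, Polynomial.coeff_X]
    fun_prop
  · exact (Polynomial.natDegree_mul_C_le _ _).trans Polynomial.natDegree_X_le

theorem add (hF : IsPolynomialFamily F) (hG : IsPolynomialFamily G) :
    IsPolynomialFamily fun l x => F l x + G l x := by
  obtain ⟨p, hp, ⟨N, hN⟩, hpF⟩ := hF
  obtain ⟨q, hq, ⟨M, hM⟩, hqG⟩ := hG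
  refine ⟨fun x => p x + q x, fun k => ?_, ⟨max N M, fun x => ?_⟩, by simp [hpF, hqG]⟩
  · simpa only [Polynomial.coeff_add] using (hp k).fun_add (hq k)
  · exact (Polynomial.natDegree_add_le _ _).trans (max_le_max (hN x) (hM x))

theorem mul (hF : IsPolynomialFamily F) (hG : IsPolynomialFamily G) :
    IsPolynomialFamily fun l x => F l x * G l x := by
  obtain ⟨p, hp, ⟨N, hN⟩, hpF⟩ := hF
  obtain ⟨q, hq, ⟨M, hM⟩, hqG⟩ := hG
  refine ⟨fun x => p x * q x, fun k => ?_, ⟨N + M, fun x => ?_⟩, by simp [hpF, hqG]⟩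
  · simp only [Polynomial.coeff_mul]
    exact continuous_finsetSum _ fun i _ => (hp _).mul (hq _)
  · exact Polynomial.natDegree_mul_le.trans (add_le_add (hN x) (hM x))

theorem sum {ι : Type*} (s : Finset ι) {F : ι → ℝ → X → ℝ} (hF : ∀ i, IsPolynomialFamily (F i)) :
    IsPolynomialFamily fun l x => ∑ i ∈ s, F i l x := by
  classical
  induction s using Finset.induction_on with
  | empty => simpa using of_continuous continuous_const
  | insert i s hi ih => simpa [Finset.sum_insert hi] using (hF i).add ih

theorem prod {ι : Type*} (s : Finset ι) {F : ι → ℝ → X → ℝ} (hF : ∀ i, IsPolynomialFamily (F i)) :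
    IsPolynomialFamily fun l x => ∏ i ∈ s, F i l x := by
  classical
  induction s using Finset.induction_on with
  | empty => simpa using of_continuous continuous_const
  | insert i s hi ih => simpa [Finset.prod_insert hi] using (hF i).mul ih

theorem exists_setIntegral_eq_eval [MeasurableSpace X] [OpensMeasurableSpace X] [T2Space X]
    (μ : Measure X) [IsFiniteMeasureOnCompacts μ] {K : Set X} (hK : IsCompact K)
    (hF : IsPolynomialFamily F) : ∃ q : Polynomial ℝ, ∀ l, ∫ x in K, F l x ∂μ = q.eval l := by
  obtain ⟨p, hp, ⟨N, hN⟩, hpF⟩ := hF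
  refine ⟨∑ k ∈ Finset.range (N + 1), Polynomial.C (∫ x in K, (p x).coeff k ∂μ) *
    Polynomial.X ^ k, fun l => ?_⟩
  have h : ∀ x, F l x = ∑ k ∈ Finset.range (N + 1), (p x).coeff k * l ^ k := fun x => by
    rw [hpF, Polynomial.eval_eq_sum_range' (Nat.lt_succ_of_le (hN x))]
  simp only [h, Polynomial.eval_finsetSum, Polynomial.eval_mul, Polynomial.eval_C,
    Polynomial.eval_pow, Polynomial.eval_X]
  rw [integral_finsetSum]
  · simp [integral_mul_const]
  · exact fun k _ => ((hp k).mul continuous_const).continuousOn.integrableOn_compact hK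

end IsPolynomialFamily

variable {E : Type*} [NormedAddCommGroup E] [NormedSpace ℝ E] [FiniteDimensional ℝ E]

theorem isPolynomialFamily_det {X : Type*} [TopologicalSpace X] {A : X → E →L[ℝ] E}
    (hA : Continuous A) :
    IsPolynomialFamily fun l x => (A x + l • ContinuousLinearMap.id ℝ E).det := by
  let b := Module.finBasis ℝ E
  have hent : ∀ i j, Continuous fun x => LinearMap.toMatrix b b (A x : E →ₗ[ℝ] E) i j := by
    intro i j
    have : (fun x => LinearMap.toMatrix b b (A x : E →ₗ[ℝ] E) i j)
        = fun x => LinearMap.toContinuousLinearMap (b.coord i) (A x (b j)) := by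
      ext x
      simp [LinearMap.toMatrix_apply]
    rw [this]
    fun_prop
  have hdet : ∀ l x, (A x + l • ContinuousLinearMap.id ℝ E).det
      = ∑ σ : Equiv.Perm (Fin (Module.finrank ℝ E)), ((Equiv.Perm.sign σ : ℤ) : ℝ) *
        ∏ i, (l * (1 : Matrix _ _ ℝ) (σ i) i +
          LinearMap.toMatrix b b (A x : E →ₗ[ℝ] E) (σ i) i) := by
    intro l x
    rw [ContinuousLinearMap.det, ← LinearMap.det_toMatrix b, Matrix.det_apply']
    refine Finset.sum_congr rfl fun σ _ => ?_
    congr 1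
    refine Finset.prod_congr rfl fun i _ => ?_
    simp [map_add, add_comm]
  simp only [hdet]
  exact .sum _ fun σ => (IsPolynomialFamily.of_continuous continuous_const).mul <|
    .prod _ fun i => (IsPolynomialFamily.param_mul continuous_const).add <|
      .of_continuous (hent _ _)

theorem det_add_smul_id_pos {A : E →L[ℝ] E} {l : ℝ} (h : ‖A‖ < l) :
    0 < (A + l • ContinuousLinearMap.id ℝ E).det := by
  have hl : 0 < l := (norm_nonneg A).trans_lt h
  have hne : ∀ s ∈ Icc (0 : ℝ) 1, (s • A + l • ContinuousLinearMap.id ℝ E).det ≠ 0 := by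
    intro s hs h0
    obtain ⟨v, hv, hv0⟩ := (Submodule.ne_bot_iff _).1
      (LinearMap.bot_lt_ker_of_det_eq_zero h0).ne'
    have h1 : s • A v = -(l • v) := by
      rw [LinearMap.mem_ker] at hv
      exact eq_neg_of_add_eq_zero_left (by simpa using hv)
    have h2 : ‖s • A v‖ = l * ‖v‖ := by rw [h1, norm_neg, norm_smul, Real.norm_of_nonneg hl.le]
    have h3 : ‖s • A v‖ ≤ ‖A‖ * ‖v‖ := by
      rw [norm_smul, Real.norm_of_nonneg hs.1]
      calc s * ‖A v‖ ≤ 1 * ‖A v‖ := by gcongr; exact hs.2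
        _ ≤ ‖A‖ * ‖v‖ := by rw [one_mul]; exact A.le_opNorm v
    have h4 := mul_lt_mul_of_pos_right h (norm_pos_iff.2 hv0)
    linarith
  have hc : ContinuousOn (fun s : ℝ => (s • A + l • ContinuousLinearMap.id ℝ E).det) (Icc 0 1) :=
    (ContinuousLinearMap.continuous_det.comp (by fun_prop)).continuousOn
  by_contra! hneg
  have h0 : 0 ≤ ((0 : ℝ) • A + l • ContinuousLinearMap.id ℝ E).det := by
    simp [ContinuousLinearMap.det]
    positivity
  obtain ⟨s, hs, hs0⟩ := intermediate_value_Icc' zero_le_one hc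
    (⟨by simpa using hneg, h0⟩ : (0 : ℝ) ∈ Icc _ _)
  exact hne s hs hs0

open scoped NNReal

theorem LipschitzWith.bijective_add_smul {L : ℝ≥0} {P : E → E} (hP : LipschitzWith L P) {l : ℝ}
    (hl : L < l) : Function.Bijective fun x => P x + l • x := by
  have hl0 : 0 < l := L.2.trans_lt hl
  refine ⟨fun x y hxy => ?_, fun y => ?_⟩
  · by_contra hne
    have h1 : l • (x - y) = -(P x - P y) := by
      rw [neg_sub, smul_sub, sub_eq_sub_iff_add_eq_add, add_comm]
      exact hxy
    have h2 : l * ‖x - y‖ = ‖P x - P y‖ := by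
      rw [← norm_neg (P x - P y), ← h1, norm_smul, Real.norm_of_nonneg hl0.le]
    have h3 := hP.norm_sub_le x y
    have h4 := mul_lt_mul_of_pos_right hl (norm_pos_iff.2 (sub_ne_zero.2 hne))
    linarith
  · have hK : LipschitzWith (L / l.toNNReal) fun x => l⁻¹ • (y - P x) := by
      refine LipschitzWith.of_dist_le_mul fun a b => ?_
      have := hP.dist_le_mul a b
      rw [dist_eq_norm, ← smul_sub, norm_smul, norm_inv, Real.norm_of_nonneg hl0.le,
        sub_sub_sub_cancel_left, ← dist_eq_norm, dist_comm]
      push_cast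
      rw [Real.coe_toNNReal _ hl0.le, div_eq_inv_mul, mul_assoc]
      gcongr
    have hc : ContractingWith (L / l.toNNReal) fun x => l⁻¹ • (y - P x) := by
      refine ⟨?_, hK⟩
      rw [div_lt_one (by simpa using hl0)]
      exact Real.lt_toNNReal_iff_coe_lt.2 hl
    have hfix := hc.fixedPoint_isFixedPt
    refine ⟨hc.fixedPoint, ?_⟩
    have := congrArg (l • ·) hfix
    simp only [smul_smul, mul_inv_cancel₀ hl0.ne', one_smul] at this
    simp only [← this]
    abel
end

section

open MeasureTheory Filter Topology NNReal
variable {E : Type*} [NormedAddCommGroup E] [NormedSpace ℝ E] [FiniteDimensional ℝ E]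

/-- Two `C¹` Lipschitz maps that agree off a compact set `K` have the same integral over `K` of
`φ ∘ P * det (DP)`, when this integrand depends polynomially on translations of `P` by multiples
of the identity. -/
theorem setIntegral_comp_mul_det_eq_of_isPolynomialFamily [MeasurableSpace E] [BorelSpace E]
    (μ : Measure E) [μ.IsAddHaarMeasure] {P₀ P₁ : E → E} {L : ℝ≥0} (h₀ : ContDiff ℝ 1 P₀)
    (h₁ : ContDiff ℝ 1 P₁) (hL₀ : LipschitzWith L P₀) (hL₁ : LipschitzWith L P₁) {K : Set E}
    (hK : IsCompact K) (hEq : EqOn P₀ P₁ Kᶜ) (φ : E → ℝ)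
    (hφ : ∀ P : E → E, Continuous P → IsPolynomialFamily fun l x => φ (P x + l • x)) :
    ∫ x in K, φ (P₀ x) * (fderiv ℝ P₀ x).det ∂μ = ∫ x in K, φ (P₁ x) * (fderiv ℝ P₁ x).det ∂μ := by
  have key : ∀ {P : E → E}, ContDiff ℝ 1 P → ∃ q : Polynomial ℝ, ∀ l : ℝ,
      ∫ x in K, φ (P x + l • x) * (fderiv ℝ P x + l • ContinuousLinearMap.id ℝ E).det ∂μ
        = q.eval l := fun {P} hP =>
    ((hφ P hP.continuous).mul (isPolynomialFamily_det
      (hP.continuous_fderiv one_ne_zero))).exists_setIntegral_eq_eval μ hK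
  have large : ∀ {P : E → E}, ContDiff ℝ 1 P → LipschitzWith L P → ∀ l : ℝ, L < l →
      ∫ x in K, φ (P x + l • x) * (fderiv ℝ P x + l • ContinuousLinearMap.id ℝ E).det ∂μ
        = ∫ y in (fun x => P x + l • x) '' K, φ y ∂μ := by
    intro P hP hL l hl
    rw [integral_image_eq_integral_abs_det_fderiv_smul μ hK.measurableSet
      (f' := fun x => fderiv ℝ P x + l • ContinuousLinearMap.id ℝ E) _
      (hL.bijective_add_smul hl).1.injOn]
    · refine setIntegral_congr_fun hK.measurableSet fun x _ => ?_
      have := det_add_smul_id_pos ((norm_fderiv_le_of_lipschitz ℝ hL (x₀ := x)).trans_lt hl)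
      simp only [smul_eq_mul, abs_of_pos this]
      ring
    · intro x _
      exact ((hP.differentiable one_ne_zero x).hasFDerivAt.add
        ((hasFDerivAt_id x).const_smul l)).hasFDerivWithinAt
  have himage : ∀ l : ℝ, L < l →
      (fun x => P₀ x + l • x) '' K = (fun x => P₁ x + l • x) '' K := by
    intro l hl
    rw [← compl_inj_iff, ← image_compl_eq (hL₀.bijective_add_smul hl),
      ← image_compl_eq (hL₁.bijective_add_smul hl)]
    exact image_congr fun x hx => by rw [hEq hx]
  obtain ⟨q₀, hq₀⟩ := key h₀
  obtain ⟨q₁, hq₁⟩ := key h₁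
  have hq : q₀ = q₁ := by
    refine Polynomial.eq_of_infinite_eval_eq _ _ ((Ioi_infinite (L : ℝ)).mono fun l hl => ?_)
    rw [mem_ofPred_eq, ← hq₀, ← hq₁, large h₀ hL₀ l hl, large h₁ hL₁ l hl, himage l hl]
  simpa using (hq₀ 0).trans ((congrArg _ hq).trans (hq₁ 0).symm)

theorem setIntegral_comp_mul_det_eq [MeasurableSpace E] [BorelSpace E]
    (μ : Measure E) [μ.IsAddHaarMeasure] {P₀ P₁ : E → E} {L : ℝ≥0} (h₀ : ContDiff ℝ 1 P₀)
    (h₁ : ContDiff ℝ 1 P₁) (hL₀ : LipschitzWith L P₀) (hL₁ : LipschitzWith L P₁) {K : Set E}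
    (hK : IsCompact K) (hEq : EqOn P₀ P₁ Kᶜ) {φ : E → ℝ} (hφ : Continuous φ) :
    ∫ x in K, φ (P₀ x) * (fderiv ℝ P₀ x).det ∂μ = ∫ x in K, φ (P₁ x) * (fderiv ℝ P₁ x).det ∂μ := by
  let S : Set C(E, ℝ) := range fun f : StrongDual ℝ E => (f : C(E, ℝ))
  let A : Subalgebra ℝ C(E, ℝ) := Algebra.adjoin ℝ S
  have hA : A.SeparatesPoints := by
    intro x y hxy
    obtain ⟨f, hf⟩ := SeparatingDual.exists_separating_of_ne (R := ℝ) hxy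
    exact ⟨f, ⟨f, Algebra.subset_adjoin ⟨f, rfl⟩, rfl⟩, hf⟩
  have hpoly : ∀ g ∈ A, ∀ P : E → E, Continuous P →
      IsPolynomialFamily fun l x => g (P x + l • x) := by
    intro g hg P hP
    induction hg using Algebra.adjoin_induction with
    | mem g hg =>
      obtain ⟨f, rfl⟩ := hg
      simp only [ContinuousMap.coe_coe, map_add, map_smul, smul_eq_mul]
      exact (IsPolynomialFamily.of_continuous (f.continuous.comp hP)).add
        (.param_mul f.continuous)
    | algebraMap r => exact .of_continuous continuous_const
    | add g₁ g₂ _ _ i₁ i₂ => exact i₁.add i₂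
    | mul g₁ g₂ _ _ i₁ i₂ => exact i₁.mul i₂
  have h_int : ∀ {P : E → E}, ContDiff ℝ 1 P → ∀ {g : E → ℝ}, Continuous g →
      IntegrableOn (fun x => g (P x) * (fderiv ℝ P x).det) K μ := fun {P} hP {g} hg =>
    ((hg.comp hP.continuous).mul (ContinuousLinearMap.continuous_det.comp
      (hP.continuous_fderiv one_ne_zero))).continuousOn.integrableOn_compact hK
  have happrox : ∀ {P : E → E}, ContDiff ℝ 1 P → ∃ M : ℝ, ∀ g : E → ℝ, Continuous g →
      ∀ ε, (∀ x ∈ K, |g (P x) - φ (P x)| ≤ ε) →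
      |∫ x in K, g (P x) * (fderiv ℝ P x).det ∂μ - ∫ x in K, φ (P x) * (fderiv ℝ P x).det ∂μ|
        ≤ ε * M := by
    intro P hP
    refine ⟨∫ x in K, |(fderiv ℝ P x).det| ∂μ, fun g hg ε h => ?_⟩
    rw [← integral_sub (h_int hP hg) (h_int hP hφ), ← integral_const_mul]
    refine norm_integral_le_of_norm_le (f := fun x => g (P x) * (fderiv ℝ P x).det -
      φ (P x) * (fderiv ℝ P x).det) ?_ ?_
    · exact (continuous_const.mul (ContinuousLinearMap.continuous_det.comp
        (hP.continuous_fderiv one_ne_zero)).abs).continuousOn.integrableOn_compact hK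
    · filter_upwards [ae_restrict_mem hK.measurableSet] with x hx
      rw [← sub_mul, norm_mul, Real.norm_eq_abs, Real.norm_eq_abs]
      gcongr
      exact h x hx
  obtain ⟨M₀, hM₀⟩ := happrox h₀
  obtain ⟨M₁, hM₁⟩ := happrox h₁
  refine eq_of_abs_sub_le_all fun δ hδ => ?_
  have hpos : 0 < δ / (|M₀| + |M₁| + 1) := by positivity
  obtain ⟨g, hgA, hg⟩ := ContinuousMap.exists_mem_subalgebra_near_continuous_of_isCompact_of_separatesPoints
    hA ⟨φ, hφ⟩ ((hK.image h₀.continuous).union (hK.image h₁.continuous)) hpos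
  have e := setIntegral_comp_mul_det_eq_of_isPolynomialFamily μ h₀ h₁ hL₀ hL₁ hK hEq g (hpoly g hgA)
  have b₀ := hM₀ g g.continuous _ fun x hx => (hg _ (.inl (mem_image_of_mem _ hx))).le
  have b₁ := hM₁ g g.continuous _ fun x hx => (hg _ (.inr (mem_image_of_mem _ hx))).le
  rw [e, abs_sub_comm] at b₀
  have hb : δ / (|M₀| + |M₁| + 1) * (M₀ + M₁) ≤ δ := by
    rw [div_mul_eq_mul_div, div_le_iff₀ (by positivity)]
    refine mul_le_mul_of_nonneg_left ?_ hδ.le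
    linarith [le_abs_self M₀, le_abs_self M₁]
  calc _ ≤ _ := abs_sub_le _ _ _
    _ ≤ _ := add_le_add b₀ b₁
    _ ≤ δ := by rw [← mul_add]; exact hb
end

section

open MeasureTheory Filter Topology NNReal
variable {E : Type*} [NormedAddCommGroup E] [NormedSpace ℝ E] [FiniteDimensional ℝ E]

/-- A `C¹` map whose zeros in `K` are all nondegenerate. -/
structure IsRegularOn (P : E → E) (K : Set E) : Prop where
  contDiff : ContDiff ℝ 1 P
  det_ne_zero : ∀ x ∈ K, P x = 0 → (fderiv ℝ P x).det ≠ 0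

theorem ContDiff.exists_openPartialHomeomorph_of_det_ne_zero {P : E → E} (hP : ContDiff ℝ 1 P)
    {x : E} (hx : (fderiv ℝ P x).det ≠ 0) :
    ∃ e : OpenPartialHomeomorph E E, x ∈ e.source ∧ (e : E → E) = P := by
  have hd : HasFDerivAt P ((fderiv ℝ P x).toContinuousLinearEquivOfDetNeZero hx : E →L[ℝ] E) x := by
    simpa using (hP.differentiable one_ne_zero x).hasFDerivAt
  exact ⟨hP.contDiffAt.toOpenPartialHomeomorph P hd one_ne_zero,
    hP.contDiffAt.mem_toOpenPartialHomeomorph_source hd one_ne_zero, rfl⟩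

/-- Near a nondegenerate zero the integrand `φ ∘ P * det (DP)` integrates to `± ∫ φ`. -/
theorem ContDiff.exists_isOpen_setIntegral_eq [MeasurableSpace E] [BorelSpace E]
    (μ : Measure E) [μ.IsAddHaarMeasure] {P : E → E} (hP : ContDiff ℝ 1 P) {x : E} (hx0 : P x = 0)
    (hx : (fderiv ℝ P x).det ≠ 0) {V : Set E} (hV : V ∈ 𝓝 x) :
    ∃ U ⊆ V, IsOpen U ∧ x ∈ U ∧ InjOn P U ∧ ∃ s : ℤ, Odd s ∧ ∃ δ > 0, ∀ φ : E → ℝ,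
      Function.support φ ⊆ ball 0 δ →
      ∫ y in U, φ (P y) * (fderiv ℝ P y).det ∂μ = s * ∫ y, φ y ∂μ := by
  obtain ⟨e, hxe, rfl⟩ := hP.exists_openPartialHomeomorph_of_det_ne_zero hx
  have hdet : Continuous fun y => (fderiv ℝ e y).det :=
    ContinuousLinearMap.continuous_det.comp (hP.continuous_fderiv one_ne_zero)
  obtain ⟨s, hs, hs'⟩ : ∃ s : ℤ, Odd s ∧ ∀ᶠ y in 𝓝 x, (fderiv ℝ e y).det
      = s * |(fderiv ℝ e y).det| := by
    rcases hx.lt_or_gt with h | h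
    · refine ⟨-1, by decide, ?_⟩
      filter_upwards [hdet.continuousAt.eventually_lt_const h] with y hy
      rw [abs_of_neg hy]; simp
    · refine ⟨1, by decide, ?_⟩
      filter_upwards [hdet.continuousAt.eventually_const_lt h] with y hy
      rw [abs_of_pos hy]; simp
  obtain ⟨U, hUsub, hUo, hxU⟩ := _root_.mem_nhds_iff.1
    (inter_mem (inter_mem hV hs') (e.open_source.mem_nhds hxe))
  have hUe : U ⊆ e.source := fun y hy => (hUsub hy).2
  have himg : e '' U ∈ 𝓝 (0 : E) :=
    hx0 ▸ (e.isOpen_image_of_subset_source hUo hUe).mem_nhds (mem_image_of_mem _ hxU)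
  obtain ⟨δ, hδ, hδU⟩ := Metric.mem_nhds_iff.1 himg
  refine ⟨U, fun y hy => (hUsub hy).1.1, hUo, hxU, e.injOn.mono hUe, s, hs, δ, hδ,
    fun φ hφ => ?_⟩
  rw [← setIntegral_eq_integral_of_forall_compl_eq_zero (s := e '' U) (f := φ),
    integral_image_eq_integral_abs_det_fderiv_smul μ hUo.measurableSet
      (f' := fderiv ℝ e)
      (fun y _ => (hP.differentiable one_ne_zero y).hasFDerivAt.hasFDerivWithinAt)
      (e.injOn.mono hUe), ← integral_const_mul]
  · refine setIntegral_congr_fun hUo.measurableSet fun y hy => ?_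
    have := (hUsub hy).1.2
    simp only [mem_ofPred_eq] at this
    simp only [smul_eq_mul]
    linear_combination φ (e y) * this
  · intro y hy
    by_contra h
    exact hy (hδU (hφ h))

theorem IsRegularOn.finite_zeros {P : E → E} {K : Set E} (hK : IsCompact K)
    (hP : IsRegularOn P K) : {x ∈ K | P x = 0}.Finite := by
  refine IsCompact.finite (hK.inter_right (isClosed_singleton.preimage hP.contDiff.continuous)) ?_
  refine isDiscrete_iff_forall_mem_exists_isOpen.2 fun x hx => ?_
  obtain ⟨e, hxe, rfl⟩ :=
    hP.contDiff.exists_openPartialHomeomorph_of_det_ne_zero (hP.det_ne_zero x hx.1 hx.2)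
  refine ⟨e.source, e.open_source, ?_⟩
  ext y
  refine ⟨fun hy => e.injOn hy.1 hxe (hy.2.2.trans hx.2.symm), ?_⟩
  rintro rfl
  exact ⟨hxe, hx⟩

theorem IsCompact.exists_pos_le_norm {X F : Type*} [TopologicalSpace X] [NormedAddCommGroup F]
    {K : Set X} (hK : IsCompact K) {f : X → F} (hf : ContinuousOn f K) (h0 : ∀ x ∈ K, f x ≠ 0) :
    ∃ c > 0, ∀ x ∈ K, c ≤ ‖f x‖ := by
  rcases K.eq_empty_or_nonempty with rfl | hne
  · exact ⟨1, one_pos, by simp⟩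
  · obtain ⟨x, hx, hmin⟩ := hK.exists_isMinOn hne hf.norm
    exact ⟨‖f x‖, norm_pos_iff.2 (h0 x hx), fun y hy => hmin hy⟩

/-- The degree integral of a regular map has the same parity as its number of zeros. -/
theorem IsRegularOn.exists_setIntegral_eq [MeasurableSpace E] [BorelSpace E]
    (μ : Measure E) [μ.IsAddHaarMeasure] {P : E → E} {K : Set E} (hK : IsCompact K)
    (hP : IsRegularOn P K) (hfr : ∀ x ∈ K, P x = 0 → x ∈ interior K) :
    ∃ m : ℤ, m ≡ {x ∈ K | P x = 0}.ncard [ZMOD 2] ∧ ∃ δ > 0, ∀ φ : E → ℝ,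
      Continuous φ → Function.support φ ⊆ ball 0 δ →
      ∫ x in K, φ (P x) * (fderiv ℝ P x).det ∂μ = m * ∫ y, φ y ∂μ := by
  have hfin := hP.finite_zeros hK
  obtain ⟨V, hV, hdisj⟩ := hfin.t2_separation
  have hU : ∀ x : E, ∃ U ⊆ interior K ∩ V x, IsOpen U ∧ ∃ s : ℤ, Odd s ∧ ∃ δ > 0,
      (x ∈ K → P x = 0 → x ∈ U ∧ ∀ φ : E → ℝ, Function.support φ ⊆ ball 0 δ →
        ∫ y in U, φ (P y) * (fderiv ℝ P y).det ∂μ = s * ∫ y, φ y ∂μ) := by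
    intro x
    by_cases hx : x ∈ K ∧ P x = 0
    · obtain ⟨U, hUV, hUo, hxU, -, s, hs, δ, hδ, h⟩ := hP.contDiff.exists_isOpen_setIntegral_eq μ
        hx.2 (hP.det_ne_zero x hx.1 hx.2) ((isOpen_interior.inter (hV x).2).mem_nhds
          ⟨hfr x hx.1 hx.2, (hV x).1⟩)
      exact ⟨U, hUV, hUo, s, hs, δ, hδ, fun _ _ => ⟨hxU, h⟩⟩
    · exact ⟨∅, empty_subset _, isOpen_empty, 1, odd_one, 1, one_pos, fun h h' => absurd ⟨h, h'⟩ hx⟩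
  choose U hUsub hUo s hs δ hδ hUs using hU
  lift {x ∈ K | P x = 0} to Finset E using hfin with Z hZ
  have hmem : ∀ {x}, x ∈ Z ↔ x ∈ K ∧ P x = 0 := fun {x} => by
    rw [← Finset.mem_coe, hZ]; rfl
  obtain ⟨c, hc, hcK⟩ := (hK.diff (isOpen_biUnion fun x (_ : x ∈ Z) => hUo x)).exists_pos_le_norm
    hP.contDiff.continuous.continuousOn fun x hx h0 => hx.2 <|
      mem_biUnion (hmem.2 ⟨hx.1, h0⟩) (hUs x hx.1 h0).1
  obtain ⟨d, hd, hdZ⟩ : ∃ d > 0, ∀ x ∈ Z, d ≤ δ x := by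
    rcases Z.eq_empty_or_nonempty with rfl | hne
    · exact ⟨1, one_pos, by simp⟩
    · exact ⟨Z.inf' hne δ, (Finset.lt_inf'_iff _).2 fun x _ => hδ x, fun x hx =>
        Finset.inf'_le _ hx⟩
  refine ⟨∑ x ∈ Z, s x, ?_, min c d, lt_min hc hd, fun φ hφ hsupp => ?_⟩
  · rw [ncard_coe_finset]
    have : ((Z.card : ℕ) : ℤ) = ∑ x ∈ Z, 1 := by simp
    rw [this]
    exact Int.ModEq.sum fun x _ => Int.emod_eq_emod_iff_emod_sub_eq_zero.2 <|
      Int.even_iff.1 ((hs x).sub_odd odd_one)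
  · have hzero : ∀ x ∈ K \ ⋃ x ∈ Z, U x, φ (P x) * (fderiv ℝ P x).det = 0 := by
      intro x hx
      have : φ (P x) = 0 := by
        by_contra h
        have := hsupp h
        rw [mem_ball_zero_iff] at this
        linarith [hcK x hx, min_le_left c d]
      rw [this, zero_mul]
    have hsub : (⋃ x ∈ Z, U x) ⊆ K :=
      iUnion₂_subset fun x _ => (hUsub x).trans (inter_subset_left.trans interior_subset)
    rw [setIntegral_eq_of_subset_of_forall_sdiff_eq_zero hK.measurableSet hsub hzero,
      integral_biUnion_finset]
    · push_cast
      rw [Finset.sum_mul]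
      refine Finset.sum_congr rfl fun x hx => (hUs x (hmem.1 hx).1 (hmem.1 hx).2).2 φ
        (hsupp.trans (ball_subset_ball ((min_le_right _ _).trans (hdZ x hx))))
    · exact fun x _ => (hUo x).measurableSet
    · exact fun x hx y hy hxy => (hdisj (hZ ▸ hx) (hZ ▸ hy) hxy).mono
        ((hUsub x).trans inter_subset_right) ((hUsub y).trans inter_subset_right)
    · intro x _
      refine IntegrableOn.mono_set ?_ ((hUsub x).trans (inter_subset_left.trans interior_subset))
      exact ((hφ.comp hP.contDiff.continuous).mul (ContinuousLinearMap.continuous_det.comp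
        (hP.contDiff.continuous_fderiv one_ne_zero))).continuousOn.integrableOn_compact hK
end

section

open MeasureTheory Filter Topology
open scoped Manifold ContDiff
variable {E : Type*} [NormedAddCommGroup E] [NormedSpace ℝ E] [FiniteDimensional ℝ E]

theorem exists_contDiff_cutoff {s t : Set E} (hs : IsClosed s) (hd : s ⊆ interior t) :
    ∃ χ : E → ℝ, ContDiff ℝ 1 χ ∧ (∀ x ∈ s, ∀ᶠ y in 𝓝 x, χ y = 1) ∧ (∀ x ∉ t, χ x = 0) ∧
      ∀ x, χ x ∈ Icc (0 : ℝ) 1 := by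
  obtain ⟨f, h1, h0, hI⟩ :=
    exists_contMDiffMap_one_nhds_of_subset_interior (n := 1) 𝓘(ℝ, E) hs hd
  exact ⟨f, f.contMDiff.contDiff, fun x hx => eventually_nhdsSet_iff_forall.1 h1 x hx, h0, hI⟩

omit [FiniteDimensional ℝ E] in
/-- Regularity on `K` depends only on germs at the zeros. -/
theorem IsRegularOn.of_eventuallyEq {P Q : E → E} {K : Set E} (hP : IsRegularOn P K)
    (hQ : ContDiff ℝ 1 Q) (h : ∀ x ∈ K, Q x = 0 → Q =ᶠ[𝓝 x] P) : IsRegularOn Q K where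
  contDiff := hQ
  det_ne_zero x hx hx0 := by
    have := h x hx hx0
    rw [this.fderiv_eq]
    exact hP.det_ne_zero x hx (this.eq_of_nhds ▸ hx0)

/-- A mod 2 Rouché theorem. -/
theorem IsRegularOn.ncard_zeros_modEq {P₀ P₁ : E → E} {K : Set E} (hK : IsCompact K)
    (h₀ : IsRegularOn P₀ K) (h₁ : IsRegularOn P₁ K)
    (hfr : ∀ x ∈ frontier K, ‖P₁ x - P₀ x‖ < ‖P₀ x‖) :
    {x ∈ K | P₀ x = 0}.ncard ≡ {x ∈ K | P₁ x = 0}.ncard [MOD 2] := by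
  borelize E
  set C : Set E := {x ∈ K | ‖P₀ x‖ ≤ ‖P₁ x - P₀ x‖} with hCdef
  have hP₀ := h₀.contDiff.continuous
  have hP₁ := h₁.contDiff.continuous
  have hCcl : IsClosed C :=
    hK.isClosed.inter (isClosed_le hP₀.norm (hP₁.sub hP₀).norm)
  have hCint : C ⊆ interior K := by
    intro x hx
    by_contra hxi
    exact (hfr x (by rw [hK.isClosed.frontier_eq]; exact ⟨hx.1, hxi⟩)).not_ge hx.2
  obtain ⟨χ, hχd, hχ1, hχ0, hχI⟩ := exists_contDiff_cutoff hCcl hCint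
  have hKth : K ⊆ interior (cthickening 1 K) :=
    (self_subset_thickening one_pos K).trans
      (interior_maximal (thickening_subset_cthickening 1 K) isOpen_thickening)
  obtain ⟨ψ, hψd, hψ1, hψ0, -⟩ := exists_contDiff_cutoff hK.isClosed hKth
  have hψs : HasCompactSupport ψ :=
    HasCompactSupport.intro hK.cthickening hψ0
  set Q₀ : E → E := fun x => ψ x • P₀ x with hQ₀
  set Q₁ : E → E := fun x => ψ x • (P₀ x + χ x • (P₁ x - P₀ x)) with hQ₁
  have hQ₀d : ContDiff ℝ 1 Q₀ := hψd.smul h₀.contDiff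
  have hQ₁d : ContDiff ℝ 1 Q₁ :=
    hψd.smul (h₀.contDiff.add (hχd.smul (h₁.contDiff.sub h₀.contDiff)))
  have hQ₀e : ∀ x ∈ K, Q₀ =ᶠ[𝓝 x] P₀ := fun x hx => by
    filter_upwards [hψ1 x hx] with y hy
    simp [hQ₀, hy]
  have hQ₁e : ∀ x ∈ C, Q₁ =ᶠ[𝓝 x] P₁ := fun x hx => by
    filter_upwards [hψ1 x hx.1, hχ1 x hx] with y hy hy'
    simp [hQ₁, hy, hy']
  have hQ₁C : ∀ x ∈ K, Q₁ x = 0 → x ∈ C := fun x hx hx0 => by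
    refine ⟨hx, ?_⟩
    have h1 : ψ x = 1 := (hψ1 x hx).self_of_nhds
    simp only [hQ₁, h1, one_smul] at hx0
    have h2 : ‖P₀ x‖ = χ x * ‖P₁ x - P₀ x‖ := by
      conv_lhs => rw [eq_neg_of_add_eq_zero_left hx0]
      rw [norm_neg, norm_smul, Real.norm_of_nonneg (hχI x).1]
    rw [h2]
    exact mul_le_of_le_one_left (norm_nonneg (P₁ x - P₀ x)) (hχI x).2
  have hP₀C : ∀ x ∈ K, P₀ x = 0 → x ∈ C := fun x hx hx0 => ⟨hx, by simp [hx0]⟩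
  have hP₁C : ∀ x ∈ K, P₁ x = 0 → x ∈ C := fun x hx hx0 => ⟨hx, by simp [hx0]⟩
  have hR₀ : IsRegularOn Q₀ K := h₀.of_eventuallyEq hQ₀d fun x hx _ => hQ₀e x hx
  have hR₁ : IsRegularOn Q₁ K := h₁.of_eventuallyEq hQ₁d fun x hx hx0 => hQ₁e x (hQ₁C x hx hx0)
  have hZ₀ : {x ∈ K | Q₀ x = 0} = {x ∈ K | P₀ x = 0} := by
    ext x
    exact and_congr_right fun hx => by rw [(hQ₀e x hx).eq_of_nhds]
  have hZ₁ : {x ∈ K | Q₁ x = 0} = {x ∈ K | P₁ x = 0} := by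
    ext x
    refine and_congr_right fun hx => ⟨fun h => ?_, fun h => ?_⟩
    · rw [← (hQ₁e x (hQ₁C x hx h)).eq_of_nhds, h]
    · rw [(hQ₁e x (hP₁C x hx h)).eq_of_nhds, h]
  obtain ⟨m₀, hm₀, δ₀, hδ₀, H₀⟩ := hR₀.exists_setIntegral_eq .addHaar hK fun x hx hx0 =>
    hCint (hP₀C x hx ((hQ₀e x hx).eq_of_nhds ▸ hx0))
  obtain ⟨m₁, hm₁, δ₁, hδ₁, H₁⟩ := hR₁.exists_setIntegral_eq .addHaar hK fun x hx hx0 =>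
    hCint (hQ₁C x hx hx0)
  have hδ : 0 < min δ₀ δ₁ := lt_min hδ₀ hδ₁
  let φ : ContDiffBump (0 : E) := ⟨min δ₀ δ₁ / 2, min δ₀ δ₁, half_pos hδ, half_lt_self hδ⟩
  have hφs : Function.support φ = ball 0 (min δ₀ δ₁) := φ.support_eq
  obtain ⟨L₀, hL₀⟩ := hQ₀d.lipschitzWith_of_hasCompactSupport hψs.smul_right one_ne_zero
  obtain ⟨L₁, hL₁⟩ := hQ₁d.lipschitzWith_of_hasCompactSupport hψs.smul_right one_ne_zero
  have hI := setIntegral_comp_mul_det_eq (.addHaar) hQ₀d hQ₁d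
    (hL₀.weaken (le_max_left L₀ L₁)) (hL₁.weaken (le_max_right L₀ L₁)) hK
    (fun x hx => by simp [hQ₀, hQ₁, hχ0 x hx]) φ.continuous
  rw [H₀ φ φ.continuous (hφs.trans_subset (ball_subset_ball (min_le_left _ _))),
    H₁ φ φ.continuous (hφs.trans_subset (ball_subset_ball (min_le_right _ _)))] at hI
  have hm : m₀ = m₁ := by
    have := mul_right_cancel₀ (φ.integral_pos (μ := .addHaar)).ne' hI
    exact_mod_cast this
  rw [← hZ₀, ← hZ₁, ← Int.natCast_modEq_iff]
  exact (hm₀.symm.trans (hm ▸ hm₁))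

theorem ContDiff.exists_norm_lt_det_ne_zero {T : E → E} (hT : ContDiff ℝ 1 T) {ε : ℝ}
    (hε : 0 < ε) : ∃ c : E, ‖c‖ < ε ∧ ∀ x, T x = c → (fderiv ℝ T x).det ≠ 0 := by
  borelize E
  set S : Set E := {x | (fderiv ℝ T x).det = 0}
  have h0 : (Measure.addHaar : Measure E) (T '' S) = 0 :=
    addHaar_image_eq_zero_of_det_fderivWithin_eq_zero _
      (fun x _ => (hT.differentiable one_ne_zero x).hasFDerivAt.hasFDerivWithinAt) fun x hx => hx
  have hb : (Measure.addHaar : Measure E) (ball 0 ε) ≠ 0 := (measure_ball_pos _ _ hε).ne'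
  by_contra! hcon
  refine hb (measure_mono_null (fun c hc => ?_) h0)
  obtain ⟨x, hx, hx'⟩ := hcon c (by simpa using hc)
  exact ⟨x, hx', hx⟩

theorem ContDiff.exists_isRegularOn_sub_const {T : E → E} (hT : ContDiff ℝ 1 T) {ε : ℝ}
    (hε : 0 < ε) : ∃ c : E, ‖c‖ < ε ∧ ∀ K, IsRegularOn (fun x => T x - c) K := by
  obtain ⟨c, hc, h⟩ := hT.exists_norm_lt_det_ne_zero hε
  refine ⟨c, hc, fun K => ⟨hT.sub contDiff_const, fun x _ hx => ?_⟩⟩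
  rw [fderiv_sub_const]
  exact h x (sub_eq_zero.1 hx)

theorem ContinuousOn.exists_contDiff_norm_sub_lt {F : E → E} {K : Set E} (hK : IsCompact K)
    (hF : ContinuousOn F K) {ε : ℝ} (hε : 0 < ε) :
    ∃ P : E → E, ContDiff ℝ 1 P ∧ ∀ x ∈ K, ‖P x - F x‖ < ε := by
  obtain ⟨g, hg⟩ := ContinuousMap.exists_restrict_eq hK.isClosed ⟨_, hF.domRestrict⟩
  have hgF : ∀ x ∈ K, g x = F x := fun x hx => by
    have := DFunLike.congr_fun hg ⟨x, hx⟩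
    simpa using this
  have huc : UniformContinuousOn g (cthickening 1 K) :=
    hK.cthickening.uniformContinuousOn_of_continuous (by fun_prop)
  obtain ⟨δ, hδ, hfδ⟩ := Metric.uniformContinuousOn_iff.1 huc (ε / 2) (half_pos hε)
  obtain ⟨P, hP, hPg⟩ := g.continuous.exists_contDiff_dist_le_of_forall_mem_ball_dist_le
    (lt_min one_pos hδ)
  refine ⟨P, hP.of_le (by simp), fun x hx => ?_⟩
  rw [← dist_eq_norm, ← hgF x hx]
  refine (hPg _ _ fun y hy => ?_).trans_lt (half_lt_self hε)
  rw [mem_ball, lt_min_iff] at hy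
  exact (hfδ _ (mem_cthickening_of_dist_le _ x _ _ hx hy.1.le) _
    (self_subset_cthickening _ hx) hy.2).le

theorem ContinuousOn.exists_isRegularOn_norm_sub_lt {F : E → E} {K : Set E} (hK : IsCompact K)
    (hF : ContinuousOn F K) {ε : ℝ} (hε : 0 < ε) :
    ∃ P : E → E, (∀ K', IsRegularOn P K') ∧ ∀ x ∈ K, ‖P x - F x‖ < ε := by
  obtain ⟨P, hP, hPF⟩ := hF.exists_contDiff_norm_sub_lt hK (half_pos hε)
  obtain ⟨c, hc, hreg⟩ := hP.exists_isRegularOn_sub_const (half_pos hε)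
  refine ⟨_, hreg, fun x hx => ?_⟩
  calc ‖P x - c - F x‖ = ‖(P x - F x) - c‖ := by congr 1; abel
    _ ≤ ‖P x - F x‖ + ‖c‖ := norm_sub_le _ _
    _ < ε := by linarith [hPF x hx]

end

section

open MeasureTheory Filter Topology
variable {E : Type*} [NormedAddCommGroup E] [NormedSpace ℝ E] [FiniteDimensional ℝ E]

omit [FiniteDimensional ℝ E] in
theorem isRegularOn_sub_const (z : E) (K : Set E) : IsRegularOn (fun x => x - z) K where
  contDiff := contDiff_id.sub contDiff_const
  det_ne_zero x _ _ := by
    rw [fderiv_sub_const]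
    simp [ContinuousLinearMap.det]

/-- If `R = Q ∘ P - a` is regular on `K`, then the number of zeros of `R` is a multiple, mod 2, of
the number of zeros of `P`, as soon as all the values of `P` at zeros of `R` are small. -/
theorem IsRegularOn.exists_ncard_zeros_comp_modEq {P Q : E → E} {K : Set E} {a : E}
    (hK : IsCompact K) (hP : IsRegularOn P K) (hQ : ContDiff ℝ 1 Q)
    (hR : IsRegularOn (fun x => Q (P x) - a) K)
    (hsmall : ∀ y ∈ K, Q (P y) = a → ∀ x ∈ frontier K, ‖P y‖ < ‖P x‖) :
    ∃ m : ℕ, {x ∈ K | Q (P x) - a = 0}.ncard ≡ m * {x ∈ K | P x = 0}.ncard [MOD 2] := by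
  classical
  have hA := hR.finite_zeros hK
  refine ⟨(hA.toFinset.image P).card, ?_⟩
  rw [Set.ncard_eq_toFinset_card _ hA, Finset.card_eq_sum_card_image P, ← smul_eq_mul,
    ← Finset.sum_const]
  refine Nat.ModEq.sum fun w hw => ?_
  obtain ⟨y, hy, rfl⟩ := Finset.mem_image.1 hw
  simp only [Finite.mem_toFinset, mem_ofPred_eq, sub_eq_zero] at hy
  have hreg : IsRegularOn (fun x => P x - P y) K := by
    refine ⟨hP.contDiff.sub contDiff_const, fun x hx hx0 => ?_⟩
    rw [fderiv_sub_const]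
    have h1 := hR.det_ne_zero x hx (by simp only [sub_eq_zero] at hx0 ⊢; rw [hx0, hy.2])
    rw [fderiv_sub_const] at h1
    have h2 : fderiv ℝ (fun x => Q (P x)) x = (fderiv ℝ Q (P x)).comp (fderiv ℝ P x) :=
      fderiv_comp x (hQ.differentiable one_ne_zero _) (hP.contDiff.differentiable one_ne_zero _)
    rw [h2] at h1
    have h3 : ((fderiv ℝ Q (P x)).comp (fderiv ℝ P x)).det
        = (fderiv ℝ Q (P x)).det * (fderiv ℝ P x).det := by
      simp only [ContinuousLinearMap.det, ContinuousLinearMap.toLinearMap_comp, LinearMap.det_comp]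
    rw [h3] at h1
    exact right_ne_zero_of_mul h1
  have hmod := hP.ncard_zeros_modEq hK hreg fun x hx => by
    simpa using hsmall y hy.1 hy.2 x hx
  refine Nat.ModEq.trans ?_ hmod.symm
  rw [← Set.ncard_coe_finset]
  suffices h : (({x ∈ hA.toFinset | P x = P y} : Finset E) : Set E) = {x ∈ K | P x - P y = 0} by
    rw [h]
  ext x
  simp only [Finset.coe_filter, Finite.mem_toFinset, mem_ofPred_eq, sub_eq_zero, and_assoc]
  exact and_congr_right fun _ => ⟨fun h => h.2, fun h => ⟨by rw [h, hy.2], h⟩⟩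

theorem OpenPartialHomeomorph.exists_odd_ncard_zeros (e : OpenPartialHomeomorph E E) {z : E}
    (hz : z ∈ e.source) (hz0 : e z = 0) {N : Set E} (hN : N ∈ 𝓝 z) :
    ∃ r > 0, closedBall z r ⊆ N ∧ ∃ ε > 0, ∀ P : E → E, IsRegularOn P (closedBall z r) →
      (∀ x ∈ closedBall z r, ‖P x - e x‖ < ε) → Odd {x ∈ closedBall z r | P x = 0}.ncard := by
  obtain ⟨ρ, hρ, hρt⟩ := nhds_basis_closedBall.mem_iff.1
    (e.open_target.mem_nhds (hz0 ▸ e.map_source hz))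
  have hpre : e ⁻¹' ball 0 (ρ / 2) ∈ 𝓝 z :=
    (e.continuousAt hz).preimage_mem_nhds (by rw [hz0]; exact ball_mem_nhds _ (half_pos hρ))
  obtain ⟨r, hr, hrs⟩ := nhds_basis_closedBall.mem_iff.1
    (inter_mem hN (inter_mem (e.open_source.mem_nhds hz) hpre))
  have hK : IsCompact (closedBall z r) := isCompact_closedBall _ _
  have hK2 : IsCompact (closedBall (0 : E) ρ) := isCompact_closedBall _ _
  have hsrc : closedBall z r ⊆ e.source := fun x hx => (hrs hx).2.1
  have heρ : ∀ x ∈ closedBall z r, ‖e x‖ < ρ / 2 := fun x hx => by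
    simpa using (hrs hx).2.2
  have hfrr : ∀ x ∈ frontier (closedBall z r), ‖x - z‖ = r := fun x hx => by
    simpa [dist_eq_norm] using frontier_closedBall_subset_sphere hx
  have hfrK : frontier (closedBall z r) ⊆ closedBall z r := isClosed_closedBall.frontier_subset
  obtain ⟨c, hc, hcle⟩ := IsCompact.exists_pos_le_norm (hK.of_isClosed_subset isClosed_frontier hfrK)
    (e.continuousOn.mono (hfrK.trans hsrc)) fun x hx h0 => by
      have : x = z := e.injOn (hsrc (hfrK hx)) hz (h0.trans hz0.symm)
      have := hfrr x hx
      simp_all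
  have hHc : ContinuousOn e.symm (closedBall 0 ρ) := e.continuousOn_symm.mono hρt
  obtain ⟨δ, hδ, hHδ⟩ := Metric.uniformContinuousOn_iff.1
    (hK2.uniformContinuousOn_of_continuous hHc) (r / 4) (by positivity)
  obtain ⟨c₂, hc₂, hc₂le⟩ := IsCompact.exists_pos_le_norm (f := fun w => e.symm w - z)
    (hK2.inter_right (isClosed_le continuous_const continuous_norm (f := fun _ => c / 4)))
    ((hHc.mono inter_subset_left).sub continuousOn_const) fun w hw h0 => by
      have h1 : e.symm w = z := sub_eq_zero.1 h0
      have h2 : w = 0 := by rw [← e.right_inv (hρt hw.1), h1, hz0]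
      have h3 : c / 4 ≤ ‖w‖ := hw.2
      rw [h2, norm_zero] at h3
      linarith
  refine ⟨r, hr, fun x hx => (hrs hx).1, min δ (min (ρ / 2) (c / 4)), by positivity,
    fun P hP hPe => ?_⟩
  have hPδ : ∀ x ∈ closedBall z r, ‖P x - e x‖ < δ := fun x hx =>
    (hPe x hx).trans_le (min_le_left _ _)
  have hPρ : ∀ x ∈ closedBall z r, ‖P x - e x‖ < ρ / 2 := fun x hx =>
    (hPe x hx).trans_le ((min_le_right _ _).trans (min_le_left _ _))
  have hPc : ∀ x ∈ closedBall z r, ‖P x - e x‖ < c / 4 := fun x hx =>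
    (hPe x hx).trans_le ((min_le_right _ _).trans (min_le_right _ _))
  have hPK2 : ∀ x ∈ closedBall z r, P x ∈ closedBall 0 ρ := fun x hx => by
    rw [mem_closedBall_zero_iff]
    have := norm_le_norm_add_norm_sub' (P x) (e x)
    linarith [hPρ x hx, heρ x hx]
  have hε₂ : 0 < min (r / 4) (c₂ / 2) := by positivity
  obtain ⟨Q, hQ, hQH⟩ := hHc.exists_contDiff_norm_sub_lt hK2 hε₂
  obtain ⟨c', hc', hreg⟩ := ((hQ.comp hP.contDiff).sub contDiff_const
    (g := fun _ => z)).exists_isRegularOn_sub_const hε₂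
  have hR : IsRegularOn (fun x => Q (P x) - (z + c')) (closedBall z r) := by
    simpa only [Function.comp, sub_sub] using hreg (closedBall z r)
  have hτ : ∀ y ∈ closedBall z r, Q (P y) = z + c' → ‖P y‖ < c / 4 := fun y hy h => by
    by_contra! hle
    have h1 := hc₂le (P y) ⟨hPK2 y hy, hle⟩
    have h2 := hQH (P y) (hPK2 y hy)
    have h3 : e.symm (P y) - z = c' - (Q (P y) - e.symm (P y)) := by rw [h]; abel
    rw [h3] at h1
    have h4 := norm_sub_le c' (Q (P y) - e.symm (P y))
    linarith [min_le_right (r / 4) (c₂ / 2)]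
  obtain ⟨m, hm⟩ := hP.exists_ncard_zeros_comp_modEq hK hQ hR fun y hy h x hx => by
    have h1 := hcle x hx
    have h2 := norm_le_norm_add_norm_sub' (e x) (P x)
    rw [norm_sub_rev] at h2
    linarith [hτ y hy h, hPc x (hfrK hx)]
  have h1 := (isRegularOn_sub_const z (closedBall z r)).ncard_zeros_modEq hK hR fun x hx => by
    have hxK := hfrK hx
    rw [hfrr x hx]
    have h2 := hQH (P x) (hPK2 x hxK)
    have h3 := hHδ (P x) (hPK2 x hxK) (e x)
      (by rw [mem_closedBall_zero_iff]; linarith [heρ x hxK]) (by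
        rw [dist_eq_norm]; exact hPδ x hxK)
    rw [dist_eq_norm, e.left_inv (hsrc hxK)] at h3
    have h4 : Q (P x) - (z + c') - (x - z)
        = (Q (P x) - e.symm (P x)) + (e.symm (P x) - x) - c' := by abel
    rw [h4]
    have h5 := norm_sub_le ((Q (P x) - e.symm (P x)) + (e.symm (P x) - x)) c'
    have h6 := norm_add_le (Q (P x) - e.symm (P x)) (e.symm (P x) - x)
    linarith [min_le_left (r / 4) (c₂ / 2)]
  have h2 : {x ∈ closedBall z r | x - z = 0} = {z} := by
    ext x
    simp only [mem_ofPred_eq, sub_eq_zero, mem_singleton_iff, and_iff_right_iff_imp]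
    rintro rfl
    exact mem_closedBall_self hr.le
  rw [h2, ncard_singleton] at h1
  exact (Nat.odd_mul.1 (Nat.odd_iff.2 (h1.trans hm).symm)).2

end

section

open MeasureTheory Filter Topology
variable {X E : Type*} [TopologicalSpace X]
  [NormedAddCommGroup E] [NormedSpace ℝ E]

/-- `F` has finitely many zeros in `K` and it is a local homeomorphism near each of them. -/
structure HasNiceZeros (F : X → E) (K : Set X) : Prop where
  finite : {x ∈ K | F x = 0}.Finite
  exists_eventuallyEq : ∀ x ∈ K, F x = 0 → ∃ e : OpenPartialHomeomorph X E,
    x ∈ e.source ∧ F =ᶠ[𝓝 x] e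

theorem Finset.exists_pos_forall_le {ι : Type*} (s : Finset ι) {f : ι → ℝ}
    (hf : ∀ i ∈ s, 0 < f i) : ∃ d > 0, ∀ i ∈ s, d ≤ f i := by
  obtain ⟨d, hd⟩ := ((Finset.eventually_all s).2 fun i hi =>
    (Ioc_mem_nhdsGT (hf i hi) : _ ∈ 𝓝[>] (0 : ℝ))).and self_mem_nhdsWithin |>.exists
  exact ⟨d, hd.2, fun i hi => (hd.1 i hi).2⟩

variable [FiniteDimensional ℝ E]

theorem HasNiceZeros.exists_ncard_zeros_modEq {F : E → E} {K : Set E} (hK : IsCompact K)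
    (hFc : ContinuousOn F K) (hF : HasNiceZeros F K) (hfr : ∀ x ∈ frontier K, F x ≠ 0) :
    ∃ ε > 0, ∀ P : E → E, IsRegularOn P K → (∀ x ∈ K, ‖P x - F x‖ < ε) →
      {x ∈ K | F x = 0}.ncard ≡ {x ∈ K | P x = 0}.ncard [MOD 2] := by
  classical
  obtain ⟨Z, hZ⟩ := hF.finite.exists_finset_coe
  have hmem : ∀ {x}, x ∈ Z ↔ x ∈ K ∧ F x = 0 := fun {x} => by
    rw [← Finset.mem_coe, hZ]; rfl
  obtain ⟨U, hU, hUd⟩ := hF.finite.t2_separation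
  rw [← hZ] at hUd
  have key : ∀ z, ∃ r > 0, ∃ ε > 0, z ∈ Z → closedBall z r ⊆ U z ∩ K ∧ ∀ P : E → E,
      IsRegularOn P K → (∀ x ∈ K, ‖P x - F x‖ < ε) →
      Odd {x ∈ closedBall z r | P x = 0}.ncard := by
    intro z
    by_cases hz : z ∈ Z
    · obtain ⟨hzK, hz0⟩ := hmem.1 hz
      have hzi : z ∈ interior K := by
        by_contra h
        exact hfr z (by rw [hK.isClosed.frontier_eq]; exact ⟨hzK, h⟩) hz0
      obtain ⟨e, hze, he⟩ := hF.exists_eventuallyEq z hzK hz0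
      have hN : (U z ∩ K) ∩ {x | F x = e x} ∈ 𝓝 z :=
        inter_mem (inter_mem ((hU z).2.mem_nhds (hU z).1) (mem_interior_iff_mem_nhds.1 hzi)) he
      obtain ⟨r, hr, hrN, ε, hε, H⟩ :=
        e.exists_odd_ncard_zeros hze (he.eq_of_nhds ▸ hz0) hN
      refine ⟨r, hr, ε, hε, fun _ => ⟨fun x hx => (hrN hx).1, fun P hP hPF => H P ?_ ?_⟩⟩
      · exact ⟨hP.contDiff, fun x hx => hP.det_ne_zero x (hrN hx).1.2⟩
      · intro x hx
        have h1 : F x = e x := (hrN hx).2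
        rw [← h1]
        exact hPF x (hrN hx).1.2
    · exact ⟨1, one_pos, 1, one_pos, fun h => absurd h hz⟩
  choose r hr ε hε H using key
  obtain ⟨d, hd, hdε⟩ := Z.exists_pos_forall_le (f := ε) fun z _ => hε z
  obtain ⟨c, hc, hcF⟩ := IsCompact.exists_pos_le_norm
    (hK.diff (isOpen_biUnion fun z (_ : z ∈ Z) => isOpen_ball (x := z) (ε := r z)))
    (hFc.mono sdiff_subset) fun x hx h0 =>
      hx.2 (mem_biUnion (hmem.2 ⟨hx.1, h0⟩) (mem_ball_self (hr x)))
  refine ⟨min c d, lt_min hc hd, fun P hP hPF => ?_⟩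
  have hU' : {x ∈ K | P x = 0} = ⋃ z ∈ (Z : Set E), {x ∈ closedBall z (r z) | P x = 0} := by
    ext x
    simp only [mem_ofPred_eq, mem_iUnion, exists_prop, Finset.mem_coe]
    constructor
    · rintro ⟨hx, hx0⟩
      by_contra hcon
      have h1 := hcF x ⟨hx, fun hx' => by
        obtain ⟨z, hz, hxz⟩ := mem_iUnion₂.1 hx'
        exact hcon ⟨z, hz, ball_subset_closedBall hxz, hx0⟩⟩
      have h2 := (hPF x hx).trans_le (min_le_left _ _)
      rw [hx0, zero_sub, norm_neg] at h2
      exact h2.not_ge h1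
    · rintro ⟨z, hz, hx, hx0⟩
      exact ⟨((H z hz).1 hx).2, hx0⟩
  have hfin : ∀ z ∈ (Z : Set E), {x ∈ closedBall z (r z) | P x = 0}.Finite := fun z hz =>
    (hP.finite_zeros hK).subset fun x hx => ⟨((H z hz).1 hx.1).2, hx.2⟩
  rw [hU', Z.finite_toSet.ncard_biUnion hfin, finsum_mem_coe_finset, ← hZ, ncard_coe_finset,
    Finset.card_eq_sum_ones]
  · refine Nat.ModEq.sum fun z hz => ?_
    exact (Nat.odd_iff.1 ((H z hz).2 P hP fun x hx =>
      (hPF x hx).trans_le ((min_le_right _ _).trans (hdε z hz)))).symm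
  · exact fun z hz w hw hzw => (hUd hz hw hzw).mono
      (fun x hx => ((H z hz).1 hx.1).1) (fun x hx => ((H w hw).1 hx.1).1)

/-- The parity of the number of zeros in `K` is determined by the boundary values. -/
theorem HasNiceZeros.ncard_zeros_modEq {F₀ F₁ : E → E} {K : Set E} (hK : IsCompact K)
    (hc₀ : ContinuousOn F₀ K) (hc₁ : ContinuousOn F₁ K)
    (h₀ : HasNiceZeros F₀ K) (h₁ : HasNiceZeros F₁ K) (hfr : ∀ x ∈ frontier K, F₀ x ≠ 0)
    (heq : ∀ x ∈ frontier K, F₀ x = F₁ x) :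
    {x ∈ K | F₀ x = 0}.ncard ≡ {x ∈ K | F₁ x = 0}.ncard [MOD 2] := by
  have hfrK : frontier K ⊆ K := hK.isClosed.frontier_subset
  obtain ⟨ε₀, hε₀, H₀⟩ := h₀.exists_ncard_zeros_modEq hK hc₀ hfr
  obtain ⟨ε₁, hε₁, H₁⟩ := h₁.exists_ncard_zeros_modEq hK hc₁ fun x hx => heq x hx ▸ hfr x hx
  obtain ⟨c, hc, hcF⟩ := (hK.of_isClosed_subset isClosed_frontier hfrK).exists_pos_le_norm
    (hc₀.mono hfrK) hfr
  have hc4 : 0 < c / 4 := by positivity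
  obtain ⟨P₀, hP₀, hPF₀⟩ := hc₀.exists_isRegularOn_norm_sub_lt hK (lt_min hε₀ hc4)
  obtain ⟨P₁, hP₁, hPF₁⟩ := hc₁.exists_isRegularOn_norm_sub_lt hK (lt_min hε₁ hc4)
  refine (H₀ P₀ (hP₀ K) fun x hx => (hPF₀ x hx).trans_le (min_le_left _ _)).trans
    (Nat.ModEq.trans ?_
      (H₁ P₁ (hP₁ K) fun x hx => (hPF₁ x hx).trans_le (min_le_left _ _)).symm)
  refine (hP₀ K).ncard_zeros_modEq hK (hP₁ K) fun x hx => ?_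
  have g₀ := (hPF₀ x (hfrK hx)).trans_le (min_le_right _ _)
  have g₁ := (hPF₁ x (hfrK hx)).trans_le (min_le_right _ _)
  have hcx := hcF x hx
  rw [← heq x hx] at g₁
  have h2 : P₁ x - P₀ x = (P₁ x - F₀ x) - (P₀ x - F₀ x) := by abel
  have h3 := norm_sub_le (P₁ x - F₀ x) (P₀ x - F₀ x)
  have h4 := norm_sub_le (P₀ x) (P₀ x - F₀ x)
  rw [sub_sub_cancel] at h4
  rw [h2]
  linarith

end

section

open MeasureTheory Filter Topology
variable {Y E : Type*} [TopologicalSpace Y] [NormedAddCommGroup E] [NormedSpace ℝ E]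

omit [NormedSpace ℝ E] in
theorem HasNiceZeros.comp_symm {G : Y → E} (hG : HasNiceZeros G univ)
    (φ : OpenPartialHomeomorph Y E) {K : Set E} (hK : K ⊆ φ.target) :
    HasNiceZeros (fun x => G (φ.symm x)) K where
  finite := by
    refine Finite.of_finite_image (f := φ.symm) (hG.finite.subset ?_)
      (φ.symm.injOn.mono fun x hx => hK hx.1)
    rintro _ ⟨x, hx, rfl⟩
    exact ⟨mem_univ _, hx.2⟩
  exists_eventuallyEq x hx hx0 := by
    obtain ⟨e, hxe, he⟩ := hG.exists_eventuallyEq _ (mem_univ _) hx0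
    refine ⟨φ.symm.trans e, ?_, (φ.continuousAt_symm (hK hx)).eventually he⟩
    rw [OpenPartialHomeomorph.trans_source]
    exact ⟨hK hx, hxe⟩

variable [FiniteDimensional ℝ E]

/-- Modifying a map inside a chart does not change the parity of the number of zeros. -/
theorem HasNiceZeros.ncard_zeros_modEq_of_eqOn_compl {G G' : Y → E} (hc : Continuous G)
    (hc' : Continuous G') (hG : HasNiceZeros G univ) (hG' : HasNiceZeros G' univ)
    (φ : OpenPartialHomeomorph Y E) {K : Set E} (hK : IsCompact K) (hKt : K ⊆ φ.target)
    (hfr : ∀ x ∈ frontier K, G (φ.symm x) ≠ 0)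
    (heq : ∀ x ∈ frontier K, G (φ.symm x) = G' (φ.symm x))
    (hout : ∀ y ∉ φ.symm '' K, G y = G' y) :
    {y | G y = 0}.ncard ≡ {y | G' y = 0}.ncard [MOD 2] := by
  have hsymm : ContinuousOn φ.symm K := φ.continuousOn_symm.mono hKt
  have key := HasNiceZeros.ncard_zeros_modEq hK (hc.comp_continuousOn hsymm)
    (hc'.comp_continuousOn hsymm) (hG.comp_symm φ hKt) (hG'.comp_symm φ hKt) hfr heq
  have himg : ∀ H : Y → E, {x ∈ K | H (φ.symm x) = 0}.ncard
      = ({y | H y = 0} ∩ φ.symm '' K).ncard := fun H => by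
    rw [← (φ.symm.injOn.mono fun x (hx : x ∈ {x ∈ K | H (φ.symm x) = 0}) => hKt hx.1).ncard_image]
    congr 1
    ext y
    constructor
    · rintro ⟨x, ⟨hx, hx0⟩, rfl⟩
      exact ⟨hx0, x, hx, rfl⟩
    · rintro ⟨hy, x, hx, rfl⟩
      exact ⟨x, ⟨hx, hy⟩, rfl⟩
  simp only [Function.comp_apply] at key
  rw [himg, himg] at key
  have hfin : {y | G y = 0}.Finite := by simpa using hG.finite
  have hfin' : {y | G' y = 0}.Finite := by simpa using hG'.finite
  rw [← ncard_inter_add_ncard_sdiff_eq_ncard _ (φ.symm '' K) hfin,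
    ← ncard_inter_add_ncard_sdiff_eq_ncard _ (φ.symm '' K) hfin']
  have hd : {y | G y = 0} \ φ.symm '' K = {y | G' y = 0} \ φ.symm '' K := by
    ext y
    constructor
    · exact fun ⟨h1, h2⟩ => ⟨(hout y h2).symm.trans h1, h2⟩
    · exact fun ⟨h1, h2⟩ => ⟨(hout y h2).trans h1, h2⟩
  rw [hd]
  exact key.add_right _

/-- Continuous maps with an odd number of zeros, all of them nondegenerate. -/
structure IsOddMap (G : Y → E) : Prop where
  continuous : Continuous G
  hasNiceZeros : HasNiceZeros G univ
  odd : Odd {y | G y = 0}.ncard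

variable [T2Space Y]

/-- Up to a small error, an odd map can be perturbed by a map supported in a chart. -/
theorem IsOddMap.exists_norm_sub_add_lt {G : Y → E} (hG : IsOddMap G)
    (φ : OpenPartialHomeomorph Y E) {a : E} {r R : ℝ} (hrR : r < R)
    (hR : closedBall a R ⊆ φ.target) {Δ : Y → E} (hΔ : Continuous Δ)
    (hΔs : ∀ y, Δ y ≠ 0 → y ∈ φ.source ∧ φ y ∈ closedBall a r) {ε : ℝ} (hε : 0 < ε) :
    ∃ G' : Y → E, IsOddMap G' ∧ (∀ y, ‖G' y - (G y + Δ y)‖ < ε) ∧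
      ∀ y ∉ φ.symm '' closedBall a R, G' y = G y := by
  classical
  obtain ⟨s₁, s₂, hrs, hs, hsR, hfree⟩ : ∃ s₁ s₂, r < s₁ ∧ s₁ < s₂ ∧ s₂ < R ∧
      ∀ y, G y = 0 → dist (φ y) a ∉ Icc s₁ s₂ := by
    have hD : ((fun y => dist (φ y) a) '' {y | G y = 0}).Finite :=
      Finite.image _ (by simpa using hG.hasNiceZeros.finite)
    obtain ⟨s, hs, hsD⟩ := (Ioo_infinite hrR).exists_notMem_finite hD
    have hn : Ioo r R \ ((fun y => dist (φ y) a) '' {y | G y = 0}) ∈ 𝓝 s :=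
      inter_mem (Ioo_mem_nhds hs.1 hs.2) (hD.isClosed.isOpen_compl.mem_nhds hsD)
    obtain ⟨δ, hδ, hball⟩ := nhds_basis_closedBall.mem_iff.1 hn
    rw [Real.closedBall_eq_Icc] at hball
    refine ⟨s - δ, s + δ, (hball ⟨le_rfl, by linarith⟩).1.1, by linarith,
      (hball ⟨by linarith, le_rfl⟩).1.2, fun y hy h => (hball h).2 ⟨y, hy, rfl⟩⟩
  have hK : IsCompact (closedBall a R) := isCompact_closedBall _ _
  have hsub : closedBall a s₂ ⊆ closedBall a R := closedBall_subset_closedBall hsR.le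
  have hsymm : ContinuousOn φ.symm (closedBall a R) := φ.continuousOn_symm.mono hR
  have hB : IsClosed (φ.symm '' closedBall a s₂) :=
    ((isCompact_closedBall a s₂).image_of_continuousOn (hsymm.mono hsub)).isClosed
  have hmemB : ∀ y ∈ φ.source, φ y ∈ closedBall a s₂ → y ∈ φ.symm '' closedBall a s₂ :=
    fun y hy hy' => ⟨φ y, hy', φ.left_inv hy⟩
  have hΔ0 : ∀ y, r < dist (φ y) a → Δ y = 0 := fun y hy => by
    by_contra h
    exact hy.not_ge (hΔs y h).2
  have hΔB : ∀ y ∉ φ.symm '' closedBall a s₂, Δ y = 0 := fun y hy => by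
    by_contra h
    exact hy (hmemB y (hΔs y h).1 (closedBall_subset_closedBall (by linarith) (hΔs y h).2))
  obtain ⟨c, hc, hcG⟩ := IsCompact.exists_pos_le_norm (f := fun x => G (φ.symm x))
    (K := closedBall a s₂ \ ball a s₁)
    ((isCompact_closedBall a s₂).diff isOpen_ball)
    (hG.continuous.comp_continuousOn (hsymm.mono (sdiff_subset.trans hsub))) fun x hx h0 => by
      refine hfree _ h0 ?_
      rw [φ.right_inv (hR (hsub hx.1))]
      exact ⟨not_lt.1 hx.2, hx.1⟩
  obtain ⟨P, hP, hPF⟩ := ContinuousOn.exists_isRegularOn_norm_sub_lt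
    (F := fun x => G (φ.symm x) + Δ (φ.symm x)) hK
    ((hG.continuous.add hΔ).comp_continuousOn hsymm) (lt_min hε hc)
  set χ : E → ℝ := fun x => max 0 (min 1 ((s₂ - dist x a) / (s₂ - s₁))) with hχ
  have hχc : Continuous χ := by
    rw [hχ]
    fun_prop
  have hs0 : 0 < s₂ - s₁ := sub_pos.2 hs
  have hχ0 : ∀ x, s₂ ≤ dist x a → χ x = 0 := fun x hx =>
    max_eq_left ((min_le_right _ _).trans (div_nonpos_of_nonpos_of_nonneg (by linarith) hs0.le))
  have hχ1 : ∀ x, dist x a ≤ s₁ → χ x = 1 := fun x hx => by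
    have : 1 ≤ (s₂ - dist x a) / (s₂ - s₁) := by rw [one_le_div hs0]; linarith
    simp only [hχ, min_eq_left this]
    norm_num
  have hχI : ∀ x, ‖χ x‖ ≤ 1 := fun x => by
    rw [Real.norm_of_nonneg (le_max_left _ _)]
    exact max_le zero_le_one (min_le_left _ _)
  set W : Y → E := fun y => if y ∈ φ.source then χ (φ y) • (P (φ y) - (G y + Δ y)) else 0 with hW
  have hWB : ∀ y ∉ φ.symm '' closedBall a s₂, W y = 0 := fun y hy => by
    simp only [hW]
    split_ifs with hys
    · rw [hχ0, zero_smul]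
      by_contra! h
      exact hy (hmemB y hys h.le)
    · rfl
  have hWc : Continuous W := by
    refine continuous_iff_continuousAt.2 fun y => ?_
    by_cases hy : y ∈ φ.source
    · have h1 : ContinuousOn (fun y => χ (φ y) • (P (φ y) - (G y + Δ y))) φ.source := by
        have h2 := φ.continuousOn
        have h3 := hG.continuous
        have h4 : Continuous P := (hP univ).contDiff.continuous
        exact (hχc.comp_continuousOn h2).smul
          ((h4.comp_continuousOn h2).sub (h3.add hΔ).continuousOn)
      refine (h1.continuousAt (φ.open_source.mem_nhds hy)).congr ?_
      filter_upwards [φ.open_source.mem_nhds hy] with w hw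
      simp [hW, hw]
    · have hyB : y ∉ φ.symm '' closedBall a s₂ := by
        rintro ⟨x, hx, rfl⟩
        exact hy (φ.map_target (hR (hsub hx)))
      refine (continuousAt_const (y := (0 : E))).congr ?_
      filter_upwards [hB.isOpen_compl.mem_nhds hyB] with w hw
      exact (hWB w hw).symm
  have hWlt : ∀ y, ‖W y‖ < min ε c := fun y => by
    by_cases hy : y ∈ φ.symm '' closedBall a s₂
    · obtain ⟨x, hx, rfl⟩ := hy
      have hxt := hR (hsub hx)
      simp only [hW, φ.map_target hxt, if_true, φ.right_inv hxt, norm_smul]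
      exact (mul_le_of_le_one_left (norm_nonneg _) (hχI x)).trans_lt (hPF x (hsub hx))
    · rw [hWB y hy, norm_zero]
      exact lt_min hε hc
  set G' : Y → E := fun y => G y + Δ y + W y with hG'
  have hc' : Continuous G' := (hG.continuous.add hΔ).add hWc
  have hG'B : ∀ y ∉ φ.symm '' closedBall a s₂, G' y = G y := fun y hy => by
    simp [hG', hΔB y hy, hWB y hy]
  have hG'P : ∀ y ∈ φ.source, dist (φ y) a ≤ s₁ → G' y = P (φ y) := fun y hy hya => by
    simp only [hG', hW, hy, if_true, hχ1 _ hya, one_smul]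
    abel
  have hG'0 : ∀ x ∈ closedBall a s₂, G' (φ.symm x) = 0 → dist x a < s₁ := fun x hx hx0 => by
    by_contra h
    have h1 := hcG x ⟨hx, h⟩
    have h2 : Δ (φ.symm x) = 0 := hΔ0 _ (by
      rw [φ.right_inv (hR (hsub hx))]
      exact hrs.trans_le (not_lt.1 h))
    simp only [hG', h2, add_zero] at hx0
    rw [eq_neg_of_add_eq_zero_left hx0, norm_neg] at h1
    exact h1.not_gt ((hWlt _).trans_le (min_le_right _ _))
  have hnice : HasNiceZeros G' univ := by
    refine ⟨?_, fun y _ hy0 => ?_⟩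
    · refine (hG.hasNiceZeros.finite.union
        (((hP (closedBall a s₂)).finite_zeros (isCompact_closedBall a s₂)).image φ.symm)).subset
        fun y hy => ?_
      by_cases hyB : y ∈ φ.symm '' closedBall a s₂
      · obtain ⟨x, hx, rfl⟩ := hyB
        refine Or.inr ⟨x, ⟨hx, ?_⟩, rfl⟩
        have hxt := hR (hsub hx)
        have h1 := hG'P (φ.symm x) (φ.map_target hxt)
        rw [φ.right_inv hxt, hy.2] at h1
        exact (h1 (hG'0 x hx hy.2).le).symm
      · exact Or.inl ⟨mem_univ _, (hG'B y hyB).symm.trans hy.2⟩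
    · by_cases hyB : y ∈ φ.symm '' closedBall a s₂
      · obtain ⟨x, hx, rfl⟩ := hyB
        have hxt := hR (hsub hx)
        have hxs := hG'0 x hx hy0
        have hev : G' =ᶠ[𝓝 (φ.symm x)] fun y => P (φ y) := by
          have hcont := φ.continuousAt (φ.map_target hxt)
          have hpre : φ ⁻¹' ball a s₁ ∈ 𝓝 (φ.symm x) :=
            hcont.preimage_mem_nhds (by
              rw [φ.right_inv hxt]
              exact isOpen_ball.mem_nhds hxs)
          filter_upwards [hpre, φ.open_source.mem_nhds (φ.map_target hxt)] with w hw hw'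
          exact hG'P w hw' (mem_ball.1 hw).le
        have hPx : P x = 0 := by
          have := hev.eq_of_nhds
          rwa [hy0, φ.right_inv hxt, eq_comm] at this
        obtain ⟨e, hxe, he⟩ := (hP {x}).contDiff.exists_openPartialHomeomorph_of_det_ne_zero
          ((hP {x}).det_ne_zero x rfl hPx)
        refine ⟨φ.trans e, ?_, ?_⟩
        · rw [OpenPartialHomeomorph.trans_source]
          exact ⟨φ.map_target hxt, by rwa [mem_preimage, φ.right_inv hxt]⟩
        · filter_upwards [hev] with w hw
          rw [hw, OpenPartialHomeomorph.trans_apply, he]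
      · obtain ⟨e, hye, he⟩ := hG.hasNiceZeros.exists_eventuallyEq y (mem_univ _)
          ((hG'B y hyB).symm.trans hy0)
        refine ⟨e, hye, ?_⟩
        filter_upwards [he, hB.isOpen_compl.mem_nhds hyB] with w hw hwB
        rw [hG'B w hwB, hw]
  have hfrs : ∀ x ∈ frontier (closedBall a s₂), dist x a = s₂ :=
    fun x hx => frontier_closedBall_subset_sphere hx
  have hmod := hG.hasNiceZeros.ncard_zeros_modEq_of_eqOn_compl hG.continuous hc' hnice φ
    (isCompact_closedBall a s₂) (hsub.trans hR) (fun x hx h0 => by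
      refine hfree _ h0 ?_
      rw [φ.right_inv (hR (hsub (isClosed_closedBall.frontier_subset hx))), hfrs x hx]
      exact ⟨hs.le, le_rfl⟩) (fun x hx => by
      have hxt := hR (hsub (isClosed_closedBall.frontier_subset hx))
      have h1 : Δ (φ.symm x) = 0 := hΔ0 _ (by
        rw [φ.right_inv hxt, hfrs x hx]
        linarith)
      have h2 : W (φ.symm x) = 0 := by
        simp only [hW, φ.map_target hxt, if_true, φ.right_inv hxt, hχ0 x (hfrs x hx).ge, zero_smul]
      simp [hG', h1, h2]) fun y hy => (hG'B y hy).symm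
  refine ⟨G', ⟨hc', hnice, ?_⟩, fun y => ?_, fun y hy => ?_⟩
  · exact Nat.odd_iff.2 (Eq.trans hmod.symm (Nat.odd_iff.1 hG.odd))
  · simp only [hG', add_sub_cancel_left]
    exact (hWlt y).trans_le (min_le_left _ _)
  · exact hG'B y fun h => hy (image_mono hsub h)

end

section

open MeasureTheory Filter Topology
variable {Y E : Type*} [TopologicalSpace Y] [NormedAddCommGroup E] [NormedSpace ℝ E]
  [FiniteDimensional ℝ E] [T2Space Y]

/-- Perturb an odd map successively in finitely many charts. -/
theorem IsOddMap.exists_norm_sub_add_sum_le {ι : Type*} {g : Y → E} (hg : IsOddMap g)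
    (φ : ι → OpenPartialHomeomorph Y E) {a : ι → E} {r R : ι → ℝ} (hrR : ∀ i, r i < R i)
    (hR : ∀ i, closedBall (a i) (R i) ⊆ (φ i).target) {Δ : ι → Y → E} (hΔ : ∀ i, Continuous (Δ i))
    (hΔs : ∀ i y, Δ i y ≠ 0 → y ∈ (φ i).source ∧ φ i y ∈ closedBall (a i) (r i))
    {ε : ℝ} (hε : 0 < ε) (s : Finset ι) :
    ∃ G' : Y → E, IsOddMap G' ∧ (∀ y, ‖G' y - (g y + ∑ i ∈ s, Δ i y)‖ ≤ s.card * ε) ∧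
      ∀ y ∉ ⋃ i ∈ s, (φ i).symm '' closedBall (a i) (R i), G' y = g y := by
  classical
  induction s using Finset.induction_on with
  | empty => exact ⟨g, hg, by simp, by simp⟩
  | insert i s his ih =>
    obtain ⟨G₁, h1, h2, h3⟩ := ih
    obtain ⟨G₂, k1, k2, k3⟩ := h1.exists_norm_sub_add_lt (φ i) (hrR i) (hR i) (hΔ i) (hΔs i) hε
    refine ⟨G₂, k1, fun y => ?_, fun y hy => ?_⟩
    · rw [Finset.sum_insert his, Finset.card_insert_of_notMem his]
      have h4 : G₂ y - (g y + (Δ i y + ∑ j ∈ s, Δ j y))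
          = (G₂ y - (G₁ y + Δ i y)) + (G₁ y - (g y + ∑ j ∈ s, Δ j y)) := by abel
      rw [h4]
      refine (norm_add_le _ _).trans ?_
      push_cast
      linarith [k2 y, h2 y]
    · rw [Finset.set_biUnion_insert, mem_union, not_or] at hy
      rw [k3 y hy.1, h3 y hy.2]

/-- A continuous map which agrees with an odd map off a compact set has a zero. -/
theorem IsOddMap.exists_eq_zero [LocallyCompactSpace Y] [ChartedSpace E Y] {g G : Y → E}
    (hg : IsOddMap g) (hG : Continuous G) {X : Set Y} (hX : IsCompact X)
    (hEq : ∀ y ∉ X, G y = g y) : ∃ y, G y = 0 := by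
  by_contra! hne
  have hch : ∀ x : Y, ∃ R > 0, closedBall (chartAt E x x) R ⊆ (chartAt E x).target := fun x =>
    nhds_basis_closedBall.mem_iff.1
      ((chartAt E x).open_target.mem_nhds ((chartAt E x).map_source (mem_chart_source E x)))
  choose R hR hRt using hch
  let U : Y → Set Y := fun x =>
    (chartAt E x).source ∩ chartAt E x ⁻¹' ball (chartAt E x x) (R x / 2)
  have hUo : ∀ x, IsOpen (U x) := fun x => (chartAt E x).isOpen_inter_preimage isOpen_ball
  obtain ⟨t, ht⟩ := hX.elim_finite_subcover U hUo fun x _ =>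
    mem_iUnion.2 ⟨x, mem_chart_source E x, mem_ball_self (half_pos (hR x))⟩
  let c : Fin t.card → Y := fun i => t.equivFin.symm i
  obtain ⟨ρ, hρs, hρ1, -, -⟩ := exists_continuous_sum_one_of_isOpen_isCompact
    (s := fun i => U (c i)) (fun i => hUo _) hX (fun y hy => by
      obtain ⟨x, hx, hyx⟩ := mem_iUnion₂.1 (ht hy)
      refine mem_iUnion.2 ⟨t.equivFin ⟨x, hx⟩, ?_⟩
      simpa [c] using hyx)
  let Δ : Fin t.card → Y → E := fun i y => ρ i y • (G y - g y)
  have hsum : ∀ y, g y + ∑ i, Δ i y = G y := fun y => by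
    simp only [Δ, ← Finset.sum_smul]
    by_cases hy : y ∈ X
    · have := hρ1 hy
      simp only [Finset.sum_apply, Pi.one_apply] at this
      rw [this, one_smul, add_sub_cancel]
    · simp [hEq y hy]
  let B : Fin t.card → Set Y := fun i =>
    (chartAt E (c i)).symm '' closedBall (chartAt E (c i) (c i)) (R (c i))
  have hB : IsCompact (⋃ i ∈ (Finset.univ : Finset (Fin t.card)), B i) :=
    Finset.isCompact_biUnion _ fun i _ => (isCompact_closedBall _ _).image_of_continuousOn
      ((chartAt E (c i)).continuousOn_symm.mono (hRt _))
  obtain ⟨κ, hκ, hκG⟩ := hB.exists_pos_le_norm hG.continuousOn fun y _ => hne y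
  have hn : (0 : ℝ) < t.card + 1 := by positivity
  obtain ⟨G', hG', hG'n, hG'B⟩ := hg.exists_norm_sub_add_sum_le (fun i => chartAt E (c i))
    (a := fun i => chartAt E (c i) (c i)) (r := fun i => R (c i) / 2) (R := fun i => R (c i))
    (fun i => half_lt_self (hR _)) (fun i => hRt _) (Δ := Δ)
    (fun i => (ρ i).continuous.smul (hG.sub hg.continuous)) (fun i y hy => by
      have h1 : y ∈ U (c i) := hρs i (subset_tsupport _ (left_ne_zero_of_smul hy))
      exact ⟨h1.1, ball_subset_closedBall h1.2⟩) (div_pos hκ hn) Finset.univ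
  have hG'0 : {y | G' y = 0} = ∅ := by
    refine eq_empty_of_forall_notMem fun y (hy : G' y = 0) => ?_
    by_cases hyB : y ∈ ⋃ i ∈ (Finset.univ : Finset (Fin t.card)), B i
    · have h1 := hG'n y
      rw [hsum, hy, zero_sub, norm_neg, Finset.card_univ, Fintype.card_fin, mul_div_assoc'] at h1
      have h2 := (hκG y hyB).trans h1
      rw [le_div_iff₀ hn] at h2
      linarith
    · have hyX : y ∉ X := fun hyX => hyB <| by
        obtain ⟨x, hx, hyx⟩ := mem_iUnion₂.1 (ht hyX)
        refine mem_iUnion₂.2 ⟨t.equivFin ⟨x, hx⟩, Finset.mem_univ _, chartAt E x y, ?_⟩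
        have h3 : c (t.equivFin ⟨x, hx⟩) = x := by simp [c]
        rw [h3]
        exact ⟨closedBall_subset_closedBall (half_le_self (hR x).le)
          (ball_subset_closedBall hyx.2), (chartAt E x).left_inv hyx.1⟩
      exact hne y ((hEq y hyX).trans ((hG'B y hyB).symm.trans hy))
  have := hG'.odd
  simp [hG'0] at this

end

section

open Filter Topology
variable {Y : Type*} [MetricSpace Y]

/-- `m x y t` is a point dividing a geodesic from `x` to `y` in the ratio `t : 1 - t`, as
characterized by the CAT(0) inequality. -/
def IsGeodesicCombo (m : Y → Y → ℝ → Y) : Prop :=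
  ∀ x y : Y, ∀ t ∈ Icc (0 : ℝ) 1, ∀ p : Y, dist p (m x y t) ^ 2 ≤
    (1 - t) * dist p x ^ 2 + t * dist p y ^ 2 - t * (1 - t) * dist x y ^ 2

theorem CAT0.exists_isGeodesicCombo (hY : CAT0 Y) : ∃ m : Y → Y → ℝ → Y, IsGeodesicCombo m := by
  choose γ hγ using hY.1
  exact ⟨fun x y t => γ x y (t * dist x y), fun x y t ht p => hY.2 x y _ (hγ x y) t ht p⟩

namespace IsGeodesicCombo

variable {m : Y → Y → ℝ → Y} (hm : IsGeodesicCombo m)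
include hm

theorem dist_left_le (x y : Y) {t : ℝ} (ht : t ∈ Icc (0 : ℝ) 1) :
    dist x (m x y t) ≤ t * dist x y := by
  refine abs_le_of_sq_le_sq' ?_ (mul_nonneg ht.1 dist_nonneg) |>.2
  have := hm x y t ht x
  rw [dist_self] at this
  linarith

theorem dist_right_le (x y : Y) {t : ℝ} (ht : t ∈ Icc (0 : ℝ) 1) :
    dist y (m x y t) ≤ (1 - t) * dist x y := by
  refine abs_le_of_sq_le_sq' ?_ (mul_nonneg (sub_nonneg.2 ht.2) dist_nonneg) |>.2
  have := hm x y t ht y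
  rw [dist_self, dist_comm y x] at this
  linarith

theorem apply_zero (x y : Y) : m x y 0 = x := by
  have := hm.dist_left_le x y (t := 0) (by simp)
  rw [zero_mul] at this
  exact (dist_le_zero.1 this).symm

theorem apply_one (x y : Y) : m x y 1 = y := by
  have := hm.dist_right_le x y (t := 1) (by simp)
  rw [sub_self, zero_mul] at this
  exact (dist_le_zero.1 this).symm

theorem eq_of_apply_eq_left {x y : Y} {t : ℝ} (ht : t ∈ Icc (0 : ℝ) 1) (ht0 : 0 < t)
    (h : m x y t = x) : y = x := by
  have h1 := hm.dist_right_le x y ht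
  rw [h, dist_comm] at h1
  have h2 : t * dist x y ≤ 0 := by linarith
  exact (dist_le_zero.1 (nonpos_of_mul_nonpos_right h2 ht0)).symm

theorem continuous {Z : Type*} [TopologicalSpace Z] {x y : Z → Y} {t : Z → ℝ}
    (hx : Continuous x) (hy : Continuous y) (ht : Continuous t) (htI : ∀ z, t z ∈ Icc (0 : ℝ) 1) :
    Continuous fun z => m (x z) (y z) (t z) := by
  refine continuous_iff_continuousAt.2 fun z₀ => ?_
  set p := m (x z₀) (y z₀) (t z₀) with hp
  set Φ : Z → ℝ := fun z => √((1 - t z) * dist p (x z) ^ 2 + t z * dist p (y z) ^ 2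
    - t z * (1 - t z) * dist (x z) (y z) ^ 2) with hΦ
  have hΦc : Continuous Φ := by
    rw [hΦ]
    fun_prop
  have hΦ0 : Φ z₀ = 0 := by
    have h1 := hm.dist_left_le (x z₀) (y z₀) (htI z₀)
    have h2 := hm.dist_right_le (x z₀) (y z₀) (htI z₀)
    rw [← hp, dist_comm] at h1 h2
    have h3 := pow_le_pow_left₀ dist_nonneg h1 2
    have h4 := pow_le_pow_left₀ dist_nonneg h2 2
    refine Real.sqrt_eq_zero_of_nonpos ?_
    have h5 := mul_le_mul_of_nonneg_left h3 (sub_nonneg.2 (htI z₀).2)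
    have h6 := mul_le_mul_of_nonneg_left h4 (htI z₀).1
    linarith
  refine tendsto_iff_dist_tendsto_zero.2 ?_
  refine squeeze_zero (fun _ => dist_nonneg) (fun z => ?_) (hΦ0 ▸ hΦc.tendsto z₀)
  rw [dist_comm]
  exact Real.le_sqrt_of_sq_le (hm _ _ _ (htI z) p)

theorem isCompact_closedBall_of_forall_lt [CompleteSpace Y] {p : Y} {r : ℝ}
    (h : ∀ s < r, IsCompact (closedBall p s)) : IsCompact (closedBall p r) := by
  rcases lt_trichotomy r 0 with hr | rfl | hr
  · simp [closedBall_eq_empty.2 hr]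
  · simp
  refine TotallyBounded.isCompact_of_isClosed (Metric.totallyBounded_iff.2 fun ε hε => ?_)
    isClosed_closedBall
  obtain ⟨s, hs0, hsr, hsε⟩ : ∃ s, 0 ≤ s ∧ s < r ∧ r - s < ε / 2 := by
    refine ⟨max 0 (r - ε / 4), le_max_left _ _, max_lt hr (by linarith), ?_⟩
    linarith [le_max_right 0 (r - ε / 4)]
  obtain ⟨F, hF, hFs⟩ := Metric.totallyBounded_iff.1 (h s hsr).totallyBounded (ε / 2) (half_pos hε)
  refine ⟨F, hF, fun y hy => ?_⟩
  have ht : s / r ∈ Icc (0 : ℝ) 1 := ⟨by positivity, (div_le_one hr).2 hsr.le⟩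
  have hy' : dist p y ≤ r := by rw [dist_comm]; exact hy
  have h1 := hm.dist_left_le p y ht
  have h2 := hm.dist_right_le p y ht
  have h3 : s / r * dist p y ≤ s :=
    (mul_le_mul_of_nonneg_left hy' ht.1).trans_eq (div_mul_cancel₀ s hr.ne')
  have h4 : (1 - s / r) * dist p y ≤ r - s := by
    refine (mul_le_mul_of_nonneg_left hy' (sub_nonneg.2 ht.2)).trans_eq ?_
    field_simp
  have h5 : m p y (s / r) ∈ closedBall p s := by
    rw [mem_closedBall, dist_comm]
    exact h1.trans h3
  obtain ⟨z, hz, hzb⟩ := mem_iUnion₂.1 (hFs h5)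
  refine mem_iUnion₂.2 ⟨z, hz, ?_⟩
  rw [mem_ball] at hzb ⊢
  linarith [dist_triangle y (m p y (s / r)) z]

theorem exists_isCompact_closedBall_add [LocallyCompactSpace Y] {p : Y} {r : ℝ} (hr : 0 ≤ r)
    (h : IsCompact (closedBall p r)) : ∃ δ > 0, IsCompact (closedBall p (r + δ)) := by
  obtain ⟨K, hK, hKr⟩ := exists_compact_superset h
  obtain ⟨δ, hδ, hδK⟩ := h.exists_cthickening_subset_open isOpen_interior hKr
  refine ⟨δ, hδ, hK.of_isClosed_subset isClosed_closedBall fun y hy =>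
    interior_subset (hδK ?_)⟩
  have hrδ : 0 < r + δ := by linarith
  have ht : r / (r + δ) ∈ Icc (0 : ℝ) 1 := ⟨by positivity, (div_le_one hrδ).2 (by linarith)⟩
  have hy' : dist p y ≤ r + δ := by rw [dist_comm]; exact hy
  have h1 := hm.dist_left_le p y ht
  have h2 := hm.dist_right_le p y ht
  have h3 : r / (r + δ) * dist p y ≤ r :=
    (mul_le_mul_of_nonneg_left hy' ht.1).trans_eq (div_mul_cancel₀ r hrδ.ne')
  have h4 : (1 - r / (r + δ)) * dist p y ≤ δ := by
    refine (mul_le_mul_of_nonneg_left hy' (sub_nonneg.2 ht.2)).trans_eq ?_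
    field_simp
    ring
  refine mem_cthickening_of_dist_le y (m p y (r / (r + δ))) δ _ ?_ (h2.trans h4)
  rw [mem_closedBall, dist_comm]
  exact h1.trans h3

/-- The Hopf–Rinow theorem. -/
theorem properSpace [CompleteSpace Y] [LocallyCompactSpace Y] : ProperSpace Y := by
  refine ⟨fun p b => ?_⟩
  by_contra hb
  set S : Set ℝ := {r | ¬ IsCompact (closedBall p r)} with hS
  have hS0 : ∀ r ∈ S, 0 ≤ r := fun r hr => by
    by_contra! h
    exact hr (by simp [closedBall_eq_empty.2 h])
  have hbdd : BddBelow S := ⟨0, hS0⟩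
  have hlt : ∀ s < sInf S, IsCompact (closedBall p s) := fun s hs => by
    by_contra h
    exact hs.not_ge (csInf_le hbdd h)
  obtain ⟨δ, hδ, hc⟩ := hm.exists_isCompact_closedBall_add (le_csInf ⟨b, hb⟩ hS0)
    (hm.isCompact_closedBall_of_forall_lt hlt)
  obtain ⟨r, hr, hrδ⟩ := exists_lt_of_csInf_lt ⟨b, hb⟩ (lt_add_of_pos_right (sInf S) hδ)
  exact hr (hc.of_isClosed_subset isClosed_closedBall (closedBall_subset_closedBall hrδ.le))

/-- A point of a uniquely geodesic manifold is the zero of an odd map vanishing only there. -/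
theorem exists_isOddMap {E : Type*} [NormedAddCommGroup E] [NormedSpace ℝ E]
    [ChartedSpace E Y] (p : Y) : ∃ g : Y → E, IsOddMap g ∧ ∀ y, g y = 0 → y = p := by
  set φ := chartAt E p
  have hpφ : p ∈ φ.source := mem_chart_source E p
  obtain ⟨ε, hε, hεφ⟩ := nhds_basis_closedBall.mem_iff.1 (φ.open_source.mem_nhds hpφ)
  set t : Y → ℝ := fun y => ε / max ε (dist p y) with ht
  have hmax : ∀ y, 0 < max ε (dist p y) := fun y => lt_max_of_lt_left hε
  have htc : Continuous t :=
    continuous_const.div (by fun_prop) fun y => (hmax y).ne'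
  have ht0 : ∀ y, 0 < t y := fun y => div_pos hε (hmax y)
  have htI : ∀ y, t y ∈ Icc (0 : ℝ) 1 := fun y =>
    ⟨(ht0 y).le, (div_le_one (hmax y)).2 (le_max_left _ _)⟩
  set c : Y → Y := fun y => m p y (t y) with hc
  have hcc : Continuous c := hm.continuous continuous_const continuous_id htc htI
  have hcφ : ∀ y, c y ∈ φ.source := fun y => by
    refine hεφ ?_
    rw [mem_closedBall, dist_comm]
    refine (hm.dist_left_le p y (htI y)).trans ?_
    rw [ht, div_mul_eq_mul_div, div_le_iff₀ (hmax y)]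
    exact mul_le_mul_of_nonneg_left (le_max_right _ _) hε.le
  have hcid : ∀ y, dist p y ≤ ε → c y = y := fun y hy => by
    have : t y = 1 := by simp only [ht, max_eq_left hy, div_self hε.ne']
    simp only [hc, this]
    exact hm.apply_one p y
  have hcp : c p = p := hcid p (by simpa using hε.le)
  have h0 : ∀ y, φ (c y) - φ p = 0 → y = p := fun y hy =>
    hm.eq_of_apply_eq_left (htI y) (ht0 y) (φ.injOn (hcφ y) hpφ (sub_eq_zero.1 hy))
  have hzero : {y | φ (c y) - φ p = 0} = {p} := by
    ext y
    refine ⟨h0 y, ?_⟩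
    rintro rfl
    simp [hcp]
  refine ⟨fun y => φ (c y) - φ p, ⟨?_, ⟨?_, fun y _ hy => ?_⟩, ?_⟩, h0⟩
  · exact (φ.continuousOn.comp_continuous hcc hcφ).sub continuous_const
  · simp [hzero]
  · obtain rfl := h0 y hy
    refine ⟨φ.transHomeomorph (Homeomorph.subRight (φ y)), hpφ, ?_⟩
    filter_upwards [closedBall_mem_nhds y hε] with w hw
    rw [mem_closedBall, dist_comm] at hw
    simp [hcid w hw]
  · simp [hzero]

end IsGeodesicCombo

end

/-- Let `Y` be a contractible, locally compact Hadamard space that is a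
topological `n`-manifold, and `h : Y → Y` a continuous map with `d(h y, y) ≤ C` for all `y`.
Then `h` is surjective. -/
theorem surjective_of_bounded_distance_from_id {n : ℕ} {Y : Type*} [MetricSpace Y]
    [ChartedSpace (EuclideanSpace ℝ (Fin n)) Y]
    (hY : Hadamard Y) [ContractibleSpace Y] [LocallyCompactSpace Y]
    (h : Y → Y) (hc : Continuous h) (C : ℝ) (hbd : ∀ y : Y, dist (h y) y ≤ C) :
    Function.Surjective h := by
  have := hY.1
  obtain ⟨m, hm⟩ := hY.2.exists_isGeodesicCombo
  have := hm.properSpace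
  intro p
  by_contra! hp
  obtain ⟨g, hg, hgp⟩ := hm.exists_isOddMap (E := EuclideanSpace ℝ (Fin n)) p
  set t : Y → ℝ := fun y => max 0 (min 1 (C + 1 - dist p y)) with ht
  have htI : ∀ y, t y ∈ Icc (0 : ℝ) 1 := fun y =>
    ⟨le_max_left _ _, max_le zero_le_one (min_le_left _ _)⟩
  set f : Y → Y := fun y => m y (h y) (t y) with hf
  have hfc : Continuous f := hm.continuous continuous_id hc (by rw [ht]; fun_prop) htI
  have hfp : ∀ y, f y ≠ p := fun y hy => by
    rcases le_or_gt (dist p y) C with hle | hlt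
    · have h1 : t y = 1 := by
        simp only [ht]
        rw [min_eq_left (by linarith), max_eq_right zero_le_one]
      simp only [hf, h1, hm.apply_one] at hy
      exact hp y hy
    · have h1 := hm.dist_left_le y (h y) (htI y)
      have h2 : t y * dist y (h y) ≤ C :=
        (mul_le_of_le_one_left dist_nonneg (htI y).2).trans (by rw [dist_comm]; exact hbd y)
      have h3 : m y (h y) (t y) = p := hy
      rw [h3, dist_comm] at h1
      linarith
  obtain ⟨y, hy⟩ := hg.exists_eq_zero (hg.continuous.comp hfc)
    (isCompact_closedBall p (C + 1)) fun y hy => by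
      have h1 : C + 1 < dist p y := by
        rw [dist_comm]
        exact not_le.1 hy
      have h2 : t y = 0 := max_eq_left ((min_le_right _ _).trans (by linarith))
      simp only [Function.comp_apply, hf, h2, hm.apply_zero]
  exact hfp y (hgp _ hy)
end

section
/- A geodesic triangle in a CAT(0) space cannot have two internal Aleksandrov angles equal to π/2 and a third internal angle positive; more precisely, if the sum of the internal Aleksandrov angles of a nondegenerate geodesic triangle in a CAT(0) space is at least π, then the triangle spans an isometrically embedded flat Euclidean triangle, so its angle sum is exactly π and it cannot have two right angles unless it is degenerate. -/
open Metric Set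

section Angle

variable {X : Type*} [MetricSpace X]

/-- The Euclidean comparison angle at the common origin of `γ` and `σ`, for parameters
`s` and `t`: the angle at the apex of a Euclidean comparison triangle with side lengths
`s`, `t` and `dist (γ s) (σ t)`. -/
noncomputable def compAngle (γ σ : ℝ → X) (s t : ℝ) : ℝ :=
  Real.arccos ((s ^ 2 + t ^ 2 - dist (γ s) (σ t) ^ 2) / (2 * s * t))

/-- The Aleksandrov angle between two geodesics `γ` (on `[0,a]`) and `σ` (on `[0,b]`)
emanating from a common point: in a CAT(0) space the comparison angle `compAngle γ σ s t`
is nondecreasing in `s` and `t`, so the angle (the limit as `s, t → 0`) equals the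
infimum of the comparison angles. -/
noncomputable def alexAngle (γ σ : ℝ → X) (a b : ℝ) : ℝ :=
  sInf {θ : ℝ | ∃ s ∈ Set.Ioc (0 : ℝ) a, ∃ t ∈ Set.Ioc (0 : ℝ) b, θ = compAngle γ σ s t}

end Angle

theorem dist_sq_convexCombo_convexCombo {E : Type*} [NormedAddCommGroup E] [InnerProductSpace ℝ E]
    (o x y : E) (a b : ℝ) :
    dist ((1 - a) • o + a • x) ((1 - b) • o + b • y) ^ 2 =
      a ^ 2 * dist o x ^ 2 + b ^ 2 * dist o y ^ 2
        - a * b * (dist o x ^ 2 + dist o y ^ 2 - dist x y ^ 2) := by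
  have h1 : (1 - a) • o + a • x - ((1 - b) • o + b • y) = a • (x - o) - b • (y - o) := by
    module
  have h2 : x - y = (x - o) - (y - o) := by abel
  rw [dist_comm o x, dist_comm o y]
  simp only [dist_eq_norm]
  rw [h1, h2, norm_sub_sq_real (x - o) (y - o), norm_sub_sq_real, norm_smul, norm_smul,
    inner_smul_left, inner_smul_right, mul_pow, mul_pow, Real.norm_eq_abs, Real.norm_eq_abs, sq_abs,
    sq_abs]
  simp only [conj_trivial]
  ring

theorem dist_sq_convexCombo {E : Type*} [NormedAddCommGroup E] [InnerProductSpace ℝ E]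
    (v o x : E) (t : ℝ) :
    dist v ((1 - t) • o + t • x) ^ 2 =
      (1 - t) * dist v o ^ 2 + t * dist v x ^ 2 - t * (1 - t) * dist o x ^ 2 := by
  have h := dist_sq_convexCombo_convexCombo o v x 1 t
  simp only [sub_self, zero_smul, zero_add, one_smul] at h
  rw [h, dist_comm o v]
  ring

theorem dist_convexCombo_convexCombo_same {E : Type*} [NormedAddCommGroup E] [NormedSpace ℝ E]
    (x y : E) (a b : ℝ) :
    dist ((1 - a) • x + a • y) ((1 - b) • x + b • y) = |a - b| * dist x y := by
  rw [dist_comm x y, dist_eq_norm, dist_eq_norm, ← Real.norm_eq_abs, ← norm_smul]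
  congr 1
  module

/-- Every triple of side lengths satisfying the triangle inequalities is realised by a triangle in the Euclidean plane. -/
theorem exists_comparison_triangle {a b c : ℝ} (hb : b ≤ c + a) (hc : c ≤ b + a)
    (ha : a ≤ c + b) (hc0 : 0 < c) (ha0 : 0 ≤ a) (hb0 : 0 ≤ b) :
    ∃ p q r : EuclideanSpace ℝ (Fin 2), dist p q = c ∧ dist q r = a ∧ dist p r = b := by
  set x : ℝ := (c ^ 2 + b ^ 2 - a ^ 2) / (2 * c) with hx
  have hxc : 2 * c * x = c ^ 2 + b ^ 2 - a ^ 2 := by rw [hx]; field_simp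
  have hxb : x ^ 2 ≤ b ^ 2 := by
    apply sq_le_sq'
    · rw [hx, le_div_iff₀ (by positivity)]
      nlinarith
    · rw [hx, div_le_iff₀ (by positivity)]
      nlinarith
  have hy := Real.sq_sqrt (sub_nonneg.2 hxb)
  refine ⟨0, !₂[c, 0], !₂[x, √(b ^ 2 - x ^ 2)], ?_, ?_, ?_⟩ <;>
    rw [EuclideanSpace.dist_eq, Fin.sum_univ_two, Real.sqrt_eq_iff_mul_self_eq (by positivity)
      (by positivity), Real.dist_eq, Real.dist_eq, sq_abs, sq_abs] <;>
    simp <;> nlinarith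

theorem EuclideanGeometry.angle_eq_arccos_dist {E : Type*} [NormedAddCommGroup E]
    [InnerProductSpace ℝ E] (x o y : E) :
    EuclideanGeometry.angle x o y = Real.arccos
      ((dist o x ^ 2 + dist o y ^ 2 - dist x y ^ 2) / (2 * dist o x * dist o y)) := by
  have h2 : x - y = (x - o) - (y - o) := by abel
  rw [EuclideanGeometry.angle, InnerProductGeometry.angle, dist_comm o x, dist_comm o y]
  simp only [dist_eq_norm, vsub_eq_sub]
  rw [h2, norm_sub_sq_real (x - o) (y - o)]
  congr 1
  rw [show ‖x - o‖ ^ 2 + ‖y - o‖ ^ 2 - (‖x - o‖ ^ 2 - 2 * inner ℝ (x - o) (y - o) + ‖y - o‖ ^ 2)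
    = 2 * inner ℝ (x - o) (y - o) by ring, mul_assoc, mul_div_mul_left _ _ two_ne_zero]

/-- The ray from `u` through `v`, both in a triangle, leaves the triangle beyond `v` at a point
of one of the sides. -/
theorem exists_extend_mem_side {E : Type*} [AddCommGroup E] [Module ℝ E] {p q r u v : E}
    (hu : u ∈ convexHull ℝ ({p, q, r} : Set E)) (hv : v ∈ convexHull ℝ ({p, q, r} : Set E))
    (huv : u ≠ v) :
    ∃ s : ℝ, 0 ≤ s ∧ (v + s • (v - u) ∈ segment ℝ p q ∨ v + s • (v - u) ∈ segment ℝ q r ∨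
      v + s • (v - u) ∈ segment ℝ r p) := by
  have key : ∀ z ∈ convexHull ℝ ({p, q, r} : Set E), ∃ w : Fin 3 → ℝ, (∀ i, 0 ≤ w i) ∧
      w 0 + w 1 + w 2 = 1 ∧ w 0 • p + w 1 • q + w 2 • r = z := by
    intro z hz
    rw [convexHull_insert (by simp), convexHull_pair, mem_convexJoin] at hz
    obtain ⟨p', hp', x, ⟨a, b, ha, hb, hab, rfl⟩, c, d, hc, hd, hcd, rfl⟩ := hz
    rw [Set.mem_singleton_iff] at hp'
    subst hp'
    refine ⟨![c, d * a, d * b], ?_, ?_, ?_⟩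
    · intro i
      fin_cases i <;> simp <;> positivity
    · simp
      linear_combination hcd + d * hab
    · simp
      module
  obtain ⟨x, hx0, hx1, rfl⟩ := key u hu
  obtain ⟨y, hy0, hy1, rfl⟩ := key v hv
  have hneg : ∃ i, y i - x i < 0 := by
    by_contra! h
    have h0 := h 0
    have h1 := h 1
    have h2 := h 2
    apply huv
    rw [show x 0 = y 0 by linarith, show x 1 = y 1 by linarith, show x 2 = y 2 by linarith]
  obtain ⟨i, hi, hmin⟩ := Finset.exists_min_image
    (Finset.univ.filter fun i => y i - x i < 0) (fun i => y i / (x i - y i))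
    (by simpa [Finset.Nonempty] using hneg)
  simp only [Finset.mem_filter, Finset.mem_univ, true_and] at hi hmin
  set s : ℝ := y i / (x i - y i) with hs
  have hs0 : 0 ≤ s := div_nonneg (hy0 i) (by linarith)
  have hw0 : ∀ j, 0 ≤ y j + s * (y j - x j) := by
    intro j
    rcases lt_or_ge (y j - x j) 0 with hj | hj
    · have := hmin j hj
      rw [le_div_iff₀ (by linarith)] at this
      linarith
    · have := hy0 j
      positivity
  have hwi : y i + s * (y i - x i) = 0 := by
    rw [hs]
    have : x i - y i ≠ 0 := by linarith
    field_simp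
    ring
  have hw1 : y 0 + s * (y 0 - x 0) + (y 1 + s * (y 1 - x 1)) + (y 2 + s * (y 2 - x 2)) = 1 := by
    linear_combination (1 + s) * hy1 - s * hx1
  have hw : (y 0 • p + y 1 • q + y 2 • r) +
      s • ((y 0 • p + y 1 • q + y 2 • r) - (x 0 • p + x 1 • q + x 2 • r)) =
      (y 0 + s * (y 0 - x 0)) • p + (y 1 + s * (y 1 - x 1)) • q +
        (y 2 + s * (y 2 - x 2)) • r := by
    module
  refine ⟨s, hs0, ?_⟩
  rw [hw]
  have h0 := hw0 0
  have h1 := hw0 1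
  have h2 := hw0 2
  fin_cases i
  · simp only [Fin.zero_eta] at hwi
    rw [hwi] at hw1 ⊢
    exact Or.inr (Or.inl ⟨_, _, h1, h2, by linarith, by module⟩)
  · simp only [Fin.mk_one] at hwi
    rw [hwi] at hw1 ⊢
    exact Or.inr (Or.inr ⟨_, _, h2, h0, by linarith, by module⟩)
  · simp only [Fin.reduceFinMk] at hwi
    rw [hwi] at hw1 ⊢
    exact Or.inl ⟨_, _, h0, h1, by linarith, by module⟩

section Geodesic

variable {X : Type*} [MetricSpace X]

theorem IsGeodesicFromTo.reverse {γ : ℝ → X} {x y : X} (h : IsGeodesicFromTo γ x y) :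
    IsGeodesicFromTo (fun t => γ (dist x y - t)) y x := by
  obtain ⟨h0, h1, h⟩ := h
  refine ⟨by simpa using h1, by simpa [dist_comm y x] using h0, ?_⟩
  rintro a ⟨ha, ha'⟩ b ⟨hb, hb'⟩
  rw [dist_comm y x] at ha' hb'
  rw [h _ ⟨by linarith, by linarith⟩ _ ⟨by linarith, by linarith⟩, abs_sub_comm]
  congr 1
  ring

theorem IsGeodesicFromTo.dist_left {γ : ℝ → X} {x y : X} (h : IsGeodesicFromTo γ x y) {t : ℝ}
    (ht : t ∈ Set.Icc (0 : ℝ) (dist x y)) : dist x (γ t) = t := by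
  have := h.2.2 0 ⟨le_rfl, dist_nonneg⟩ t ht
  rwa [h.1, zero_sub, abs_neg, abs_of_nonneg ht.1] at this

theorem mul_dist_mem_Icc (x y : X) {t : ℝ} (ht : t ∈ Set.Icc (0 : ℝ) 1) :
    t * dist x y ∈ Set.Icc 0 (dist x y) :=
  ⟨mul_nonneg ht.1 dist_nonneg, mul_le_of_le_one_left dist_nonneg ht.2⟩

theorem IsGeodesicFromTo.dist_mul {γ : ℝ → X} {x y : X} (h : IsGeodesicFromTo γ x y) {s t : ℝ}
    (hs : s ∈ Set.Icc (0 : ℝ) 1) (ht : t ∈ Set.Icc (0 : ℝ) 1) :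
    dist (γ (s * dist x y)) (γ (t * dist x y)) = |s - t| * dist x y := by
  rw [h.2.2 _ (mul_dist_mem_Icc x y hs) _ (mul_dist_mem_Icc x y ht), ← sub_mul, abs_mul,
    abs_of_nonneg (dist_nonneg (x := x) (y := y))]

/-- Two-sided comparison: points on two sides of a geodesic triangle are no further apart than
their comparison points. -/
theorem CAT0.dist_le_of_comparison {E : Type*} [NormedAddCommGroup E] [InnerProductSpace ℝ E]
    (hX : CAT0 X) {p x y : X} {g h : ℝ → X}
    (hg : IsGeodesicFromTo g p x) (hh : IsGeodesicFromTo h p y) {p' x' y' : E}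
    (hpx : dist p x = dist p' x') (hpy : dist p y = dist p' y') (hxy : dist x y = dist x' y')
    {s t : ℝ} (hs : s ∈ Set.Icc (0 : ℝ) 1) (ht : t ∈ Set.Icc (0 : ℝ) 1) :
    dist (g (s * dist p x)) (h (t * dist p y)) ≤
      dist ((1 - s) • p' + s • x') ((1 - t) • p' + t • y') := by
  refine le_of_sq_le_sq ?_ dist_nonneg
  have h1 := hX.2 p x g hg s hs (h (t * dist p y))
  have h2 := hX.2 p y h hh t ht x
  have h3 := hh.dist_left (mul_dist_mem_Icc p y ht)
  rw [dist_comm p] at h3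
  rw [h3, dist_comm (h _) x] at h1
  rw [dist_sq_convexCombo_convexCombo, dist_comm (g _), ← hpx, ← hpy, ← hxy]
  rw [dist_comm x p] at h2
  nlinarith [mul_le_mul_of_nonneg_left h2 hs.1]

theorem alexAngle_le_compAngle (γ σ : ℝ → X) {a b s t : ℝ} (hs : s ∈ Set.Ioc 0 a)
    (ht : t ∈ Set.Ioc 0 b) : alexAngle γ σ a b ≤ compAngle γ σ s t := by
  refine csInf_le ⟨0, ?_⟩ ⟨s, hs, t, ht, rfl⟩
  rintro _ ⟨_, _, _, _, rfl⟩
  exact Real.arccos_nonneg _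

/-- If the Aleksandrov angle attains its Euclidean comparison value, distances between points on
the two sides are at least the comparison distances. -/
theorem sq_le_dist_sq_of_compAngle_le_alexAngle {o x y : X} {γ σ : ℝ → X}
    (hγ : IsGeodesicFromTo γ o x) (hσ : IsGeodesicFromTo σ o y)
    (hx : 0 < dist o x) (hy : 0 < dist o y)
    (h : compAngle γ σ (dist o x) (dist o y) ≤ alexAngle γ σ (dist o x) (dist o y))
    {s t : ℝ} (hs : s ∈ Set.Icc (0 : ℝ) 1) (ht : t ∈ Set.Icc (0 : ℝ) 1) :
    s ^ 2 * dist o x ^ 2 + t ^ 2 * dist o y ^ 2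
        - s * t * (dist o x ^ 2 + dist o y ^ 2 - dist x y ^ 2) ≤
      dist (γ (s * dist o x)) (σ (t * dist o y)) ^ 2 := by
  have hs' := mul_dist_mem_Icc o x hs
  have ht' := mul_dist_mem_Icc o y ht
  rcases hs.1.eq_or_lt with rfl | hs0
  · rw [zero_mul (dist o x), hγ.1, hσ.dist_left ht']
    apply le_of_eq
    ring
  rcases ht.1.eq_or_lt with rfl | ht0
  · rw [zero_mul (dist o y), hσ.1, dist_comm (γ _), hγ.dist_left hs']
    apply le_of_eq
    ring
  have hle := h.trans (alexAngle_le_compAngle γ σ (s := s * dist o x) (t := t * dist o y)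
    ⟨by positivity, hs'.2⟩ ⟨by positivity, ht'.2⟩)
  rw [compAngle, compAngle, hγ.2.1, hσ.2.1] at hle
  have h1 := hγ.dist_left hs'
  have h2 := hσ.dist_left ht'
  have hxy := abs_dist_sub_le x y o
  have hst := abs_dist_sub_le (γ (s * dist o x)) (σ (t * dist o y)) o
  rw [dist_comm _ o, dist_comm _ o] at hxy hst
  rw [h1, h2] at hst
  have htri : dist x y ≤ dist o x + dist o y := dist_triangle_left x y o
  set a := dist o x
  set b := dist o y
  set c := dist x y
  set d := dist (γ (s * a)) (σ (t * b))
  have hc0 : 0 ≤ c := dist_nonneg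
  have hlow : -1 ≤ (a ^ 2 + b ^ 2 - c ^ 2) / (2 * a * b) := by
    rw [le_div_iff₀ (by positivity)]
    nlinarith
  have hup : ((s * a) ^ 2 + (t * b) ^ 2 - d ^ 2) / (2 * (s * a) * (t * b)) ≤ 1 := by
    rw [div_le_one (by positivity)]
    have := sq_le_sq' (by linarith [abs_nonneg (s * a - t * b)]) hst
    rw [sq_abs] at this
    nlinarith
  have hratio : ((s * a) ^ 2 + (t * b) ^ 2 - d ^ 2) / (2 * (s * a) * (t * b)) ≤
      (a ^ 2 + b ^ 2 - c ^ 2) / (2 * a * b) := by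
    by_contra! hlt
    exact absurd hle (not_le.2 (Real.strictAntiOn_arccos ⟨hlow, hlt.le.trans hup⟩
      ⟨hlow.trans hlt.le, hup⟩ hlt))
  rw [div_le_div_iff₀ (by positivity) (by positivity)] at hratio
  have hab : 0 < 2 * a * b := by positivity
  refine le_of_mul_le_mul_left ?_ hab
  nlinarith

variable {E : Type*} [NormedAddCommGroup E] [InnerProductSpace ℝ E]

theorem IsGeodesicFromTo.compAngle_eq_angle {o x y : X} {γ σ : ℝ → X}
    (hγ : IsGeodesicFromTo γ o x) (hσ : IsGeodesicFromTo σ y o) {o' x' y' : E}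
    (hox : dist o x = dist o' x') (hoy : dist y o = dist y' o') (hxy : dist x y = dist x' y') :
    compAngle γ (fun t => σ (dist y o - t)) (dist o x) (dist y o) =
      EuclideanGeometry.angle x' o' y' := by
  rw [compAngle, sub_self, hγ.2.1, hσ.1, EuclideanGeometry.angle_eq_arccos_dist, hox, hxy, hoy,
    dist_comm y' o']

/-- If the Aleksandrov angle at `o` is at least the comparison angle, then points on the sides
adjacent to `o` are at least as far apart as their comparison points. -/
theorem dist_comparison_le_of_angle_le_alexAngle {o x y : X} {γ σ : ℝ → X}
    (hγ : IsGeodesicFromTo γ o x) (hσ : IsGeodesicFromTo σ y o)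
    (hx : 0 < dist o x) (hy : 0 < dist y o) {o' x' y' : E}
    (hox : dist o x = dist o' x') (hoy : dist y o = dist y' o') (hxy : dist x y = dist x' y')
    (h : EuclideanGeometry.angle x' o' y' ≤
      alexAngle γ (fun t => σ (dist y o - t)) (dist o x) (dist y o))
    {s t : ℝ} (hs : s ∈ Set.Icc (0 : ℝ) 1) (ht : t ∈ Set.Icc (0 : ℝ) 1) :
    dist ((1 - s) • o' + s • x') ((1 - t) • y' + t • o') ≤
      dist (γ (s * dist o x)) (σ (t * dist y o)) := by
  rw [← hγ.compAngle_eq_angle hσ hox hoy hxy] at h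
  have hrev := hσ.reverse
  have hpt : dist y o - (1 - t) * dist y o = t * dist y o := by ring
  obtain ⟨τ, hτ⟩ : ∃ τ, τ = fun t => σ (dist y o - t) := ⟨_, rfl⟩
  have hτt : σ (t * dist y o) = τ ((1 - t) * dist y o) := by
    simp only [hτ, hpt]
  rw [← hτ] at h hrev
  rw [hτt]
  rw [dist_comm y o] at h hy hoy ⊢
  rw [dist_comm y' o'] at hoy
  refine le_of_sq_le_sq ?_ dist_nonneg
  have key := sq_le_dist_sq_of_compAngle_le_alexAngle hγ hrev hx hy h hs
    (t := 1 - t) ⟨by linarith [ht.2], by linarith [ht.1]⟩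
  refine le_trans (le_of_eq ?_) key
  have hpt' : (1 - t) • y' + t • o' = (1 - (1 - t)) • o' + (1 - t) • y' := by module
  rw [hox, hoy, hxy, ← dist_sq_convexCombo_convexCombo, hpt']

/-- A geodesic triangle in a CAT(0) space whose boundary is no shorter than the boundary of its
comparison triangle bounds an isometrically embedded Euclidean triangle. -/
theorem CAT0.exists_isometric_filling (hX : CAT0 X) {p q r : X} {γpq γqr γrp : ℝ → X}
    (hpq : IsGeodesicFromTo γpq p q) (hqr : IsGeodesicFromTo γqr q r)
    (hrp : IsGeodesicFromTo γrp r p) {p' q' r' : E}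
    (dpq : dist p q = dist p' q') (dqr : dist q r = dist q' r') (drp : dist r p = dist r' p')
    (hp : ∀ s ∈ Set.Icc (0 : ℝ) 1, ∀ t ∈ Set.Icc (0 : ℝ) 1,
      dist ((1 - s) • p' + s • q') ((1 - t) • r' + t • p') ≤
        dist (γpq (s * dist p q)) (γrp (t * dist r p)))
    (hq : ∀ s ∈ Set.Icc (0 : ℝ) 1, ∀ t ∈ Set.Icc (0 : ℝ) 1,
      dist ((1 - s) • q' + s • r') ((1 - t) • p' + t • q') ≤
        dist (γqr (s * dist q r)) (γpq (t * dist p q)))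
    (hr : ∀ s ∈ Set.Icc (0 : ℝ) 1, ∀ t ∈ Set.Icc (0 : ℝ) 1,
      dist ((1 - s) • r' + s • p') ((1 - t) • q' + t • r') ≤
        dist (γrp (s * dist r p)) (γqr (t * dist q r))) :
    ∃ f : E → X, f p' = p ∧ f q' = q ∧ f r' = r ∧
      ∀ u ∈ convexHull ℝ ({p', q', r'} : Set E), ∀ v ∈ convexHull ℝ ({p', q', r'} : Set E),
        dist (f u) (f v) = dist u v := by
  have h0 : (0 : ℝ) ∈ Set.Icc (0 : ℝ) 1 := ⟨le_rfl, zero_le_one⟩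
  have h1 : (1 : ℝ) ∈ Set.Icc (0 : ℝ) 1 := ⟨zero_le_one, le_rfl⟩
  have hcevian : ∀ w ∈ Set.Icc (0 : ℝ) 1,
      dist p (γqr (w * dist q r)) = dist p' ((1 - w) • q' + w • r') := by
    intro w hw
    apply le_antisymm
    · refine le_of_sq_le_sq ?_ dist_nonneg
      rw [dist_sq_convexCombo, ← dpq, ← dqr, dist_comm p' r', ← drp, dist_comm r p]
      exact hX.2 q r γqr hqr w hw p
    · have := hq w hw 0 h0
      simp only [sub_zero, one_smul, zero_smul, add_zero, zero_mul, hpq.1] at this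
      rwa [dist_comm p', dist_comm p]
  let R : E → X → Prop := fun u z => ∃ t ∈ Set.Icc (0 : ℝ) 1, ∃ w ∈ Set.Icc (0 : ℝ) 1,
    ∃ g, IsGeodesicFromTo g p (γqr (w * dist q r)) ∧
      u = (1 - t) • p' + t • ((1 - w) • q' + w • r') ∧
      z = g (t * dist p (γqr (w * dist q r)))
  have hlip : ∀ u z v y, R u z → R v y → dist z y ≤ dist u v := by
    rintro _ _ _ _ ⟨s, hs, w, hw, g, hg, rfl, rfl⟩ ⟨t, ht, x, hx, h, hh, rfl, rfl⟩
    refine hX.dist_le_of_comparison hg hh (hcevian w hw) (hcevian x hx) ?_ hs ht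
    rw [hqr.dist_mul hw hx, dist_convexCombo_convexCombo_same, dqr]
  have hRpq : ∀ s ∈ Set.Icc (0 : ℝ) 1, R ((1 - s) • p' + s • q') (γpq (s * dist p q)) := by
    intro s hs
    have e : γqr (0 * dist q r) = q := by rw [zero_mul, hqr.1]
    refine ⟨s, hs, 0, h0, γpq, ?_, ?_, ?_⟩
    · rwa [e]
    · module
    · rw [e]
  have hRqr : ∀ s ∈ Set.Icc (0 : ℝ) 1, R ((1 - s) • q' + s • r') (γqr (s * dist q r)) := by
    intro s hs
    obtain ⟨g, hg⟩ := hX.1 p (γqr (s * dist q r))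
    refine ⟨1, h1, s, hs, g, hg, ?_, ?_⟩
    · module
    · rw [one_mul, hg.2.1]
  have hRrp : ∀ s ∈ Set.Icc (0 : ℝ) 1, R ((1 - s) • r' + s • p') (γrp (s * dist r p)) := by
    intro s hs
    have e : γqr (1 * dist q r) = r := by rw [one_mul, hqr.2.1]
    refine ⟨1 - s, ⟨by linarith [hs.2], by linarith [hs.1]⟩, 1, h1,
      fun t => γrp (dist r p - t), ?_, ?_, ?_⟩
    · rw [e]
      exact hrp.reverse
    · module
    · rw [e, dist_comm p r]
      congr 1
      ring
  let S : E → X → Prop := fun u z =>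
    (∃ s ∈ Set.Icc (0 : ℝ) 1, u = (1 - s) • p' + s • q' ∧ z = γpq (s * dist p q)) ∨
    (∃ s ∈ Set.Icc (0 : ℝ) 1, u = (1 - s) • q' + s • r' ∧ z = γqr (s * dist q r)) ∨
    (∃ s ∈ Set.Icc (0 : ℝ) 1, u = (1 - s) • r' + s • p' ∧ z = γrp (s * dist r p))
  have hSR : ∀ u z, S u z → R u z := by
    rintro u z (⟨s, hs, rfl, rfl⟩ | ⟨s, hs, rfl, rfl⟩ | ⟨s, hs, rfl, rfl⟩)
    exacts [hRpq s hs, hRqr s hs, hRrp s hs]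
  have hS : ∀ u z v y, S u z → S v y → dist u v ≤ dist z y := by
    rintro u z v y (⟨s, hs, rfl, rfl⟩ | ⟨s, hs, rfl, rfl⟩ | ⟨s, hs, rfl, rfl⟩)
      (⟨t, ht, rfl, rfl⟩ | ⟨t, ht, rfl, rfl⟩ | ⟨t, ht, rfl, rfl⟩)
    · rw [hpq.dist_mul hs ht, dist_convexCombo_convexCombo_same, dpq]
    · rw [dist_comm, dist_comm (γpq _)]
      exact hq t ht s hs
    · exact hp s hs t ht
    · exact hq s hs t ht
    · rw [hqr.dist_mul hs ht, dist_convexCombo_convexCombo_same, dqr]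
    · rw [dist_comm, dist_comm (γqr _)]
      exact hr t ht s hs
    · rw [dist_comm, dist_comm (γrp _)]
      exact hp t ht s hs
    · exact hr s hs t ht
    · rw [hrp.dist_mul hs ht, dist_convexCombo_convexCombo_same, drp]
  have hside : ∀ u, (u ∈ segment ℝ p' q' ∨ u ∈ segment ℝ q' r' ∨ u ∈ segment ℝ r' p') →
      ∃ z, S u z := by
    simp only [segment_eq_image, Set.mem_image]
    rintro u (⟨s, hs, rfl⟩ | ⟨s, hs, rfl⟩ | ⟨s, hs, rfl⟩)
    exacts [⟨_, Or.inl ⟨s, hs, rfl, rfl⟩⟩, ⟨_, Or.inr (Or.inl ⟨s, hs, rfl, rfl⟩)⟩,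
      ⟨_, Or.inr (Or.inr ⟨s, hs, rfl, rfl⟩)⟩]
  have hex : ∀ u ∈ convexHull ℝ ({p', q', r'} : Set E), ∃ z, R u z := by
    intro u hu
    rw [convexHull_insert (by simp), convexHull_pair, mem_convexJoin] at hu
    obtain ⟨a, ha, b, hb, hu⟩ := hu
    rw [Set.mem_singleton_iff] at ha
    subst ha
    rw [segment_eq_image] at hb hu
    obtain ⟨w, hw, rfl⟩ := hb
    obtain ⟨t, ht, rfl⟩ := hu
    obtain ⟨g, hg⟩ := hX.1 p (γqr (w * dist q r))
    exact ⟨_, t, ht, w, hw, g, hg, rfl, rfl⟩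
  classical
  let f : E → X := fun u => if h : ∃ z, R u z then h.choose else p
  have hf : ∀ u z, R u z → R u (f u) := by
    intro u z hz
    have h : ∃ z, R u z := ⟨z, hz⟩
    simp only [f, dif_pos h]
    exact h.choose_spec
  have hfeq : ∀ u z, R u z → f u = z := fun u z hz =>
    dist_le_zero.1 ((hlip _ _ _ _ (hf u z hz) hz).trans_eq (dist_self u))
  refine ⟨f, ?_, ?_, ?_, ?_⟩
  · have := hRpq 0 h0
    simp only [sub_zero, one_smul, zero_smul, add_zero, zero_mul, hpq.1] at this
    exact hfeq _ _ this
  · have := hRqr 0 h0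
    simp only [sub_zero, one_smul, zero_smul, add_zero, zero_mul, hqr.1] at this
    exact hfeq _ _ this
  · have := hRrp 0 h0
    simp only [sub_zero, one_smul, zero_smul, add_zero, zero_mul, hrp.1] at this
    exact hfeq _ _ this
  intro u hu v hv
  obtain ⟨zu, hzu⟩ := hex u hu
  obtain ⟨zv, hzv⟩ := hex v hv
  have hRu := hf u zu hzu
  have hRv := hf v zv hzv
  refine le_antisymm (hlip _ _ _ _ hRu hRv) ?_
  rcases eq_or_ne u v with rfl | huv
  · simp
  obtain ⟨s, hs, hb⟩ := exists_extend_mem_side hu hv huv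
  obtain ⟨t, ht, ha⟩ := exists_extend_mem_side hv hu huv.symm
  obtain ⟨za, hza⟩ := hside _ ha
  obtain ⟨zb, hzb⟩ := hside _ hb
  have hab := hS _ _ _ _ hza hzb
  have hau := hlip _ _ _ _ (hSR _ _ hza) hRu
  have hvb := hlip _ _ _ _ hRv (hSR _ _ hzb)
  have e1 : dist (u + t • (u - v)) (v + s • (v - u)) = (1 + s + t) * dist u v := by
    rw [dist_eq_norm, dist_eq_norm, ← abs_of_nonneg (show 0 ≤ 1 + s + t by positivity),
      ← Real.norm_eq_abs, ← norm_smul]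
    congr 1
    module
  have e2 : dist (u + t • (u - v)) u = t * dist u v := by
    rw [dist_eq_norm, dist_eq_norm, add_sub_cancel_left, norm_smul, Real.norm_of_nonneg ht]
  have e3 : dist v (v + s • (v - u)) = s * dist u v := by
    rw [dist_comm, dist_comm u v, dist_eq_norm, dist_eq_norm, add_sub_cancel_left, norm_smul,
      Real.norm_of_nonneg hs]
  have htri := dist_triangle4 za (f u) (f v) zb
  rw [e1] at hab
  rw [e2] at hau
  rw [e3] at hvb
  linarith

end Geodesic

/-- In a CAT(0) space, if the sum of the internal Aleksandrov angles of a
nondegenerate geodesic triangle is at least `π`, then the triangle spans an isometrically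
embedded flat Euclidean triangle; hence its angle sum is exactly `π` and it cannot have two
right angles together with a positive third angle. -/
theorem flat_triangle_of_angle_sum_ge_pi {X : Type*} [MetricSpace X] (hX : CAT0 X)
    (p q r : X)
    -- nondegenerate: strict triangle inequalities
    (hnd₁ : dist p r < dist p q + dist q r)
    (hnd₂ : dist p q < dist p r + dist r q)
    (hnd₃ : dist q r < dist q p + dist p r)
    (γpq γqr γrp : ℝ → X)
    (hpq : IsGeodesicFromTo γpq p q) (hqr : IsGeodesicFromTo γqr q r)
    (hrp : IsGeodesicFromTo γrp r p)
    -- the internal Aleksandrov angles at p, q, r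
    (A B C : ℝ)
    (hA : A = alexAngle γpq (fun t => γrp (dist r p - t)) (dist p q) (dist r p))
    (hB : B = alexAngle γqr (fun t => γpq (dist p q - t)) (dist q r) (dist p q))
    (hC : C = alexAngle γrp (fun t => γqr (dist q r - t)) (dist r p) (dist q r))
    (hsum : Real.pi ≤ A + B + C) :
    (∃ (p' q' r' : EuclideanSpace ℝ (Fin 2)) (f : EuclideanSpace ℝ (Fin 2) → X),
        f p' = p ∧ f q' = q ∧ f r' = r ∧
        ∀ u ∈ convexHull ℝ ({p', q', r'} : Set (EuclideanSpace ℝ (Fin 2))),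
          ∀ v ∈ convexHull ℝ ({p', q', r'} : Set (EuclideanSpace ℝ (Fin 2))),
            dist (f u) (f v) = dist u v) ∧
      A + B + C = Real.pi ∧
      ¬((A = Real.pi / 2 ∧ B = Real.pi / 2 ∧ 0 < C) ∨
        (A = Real.pi / 2 ∧ C = Real.pi / 2 ∧ 0 < B) ∨
        (B = Real.pi / 2 ∧ C = Real.pi / 2 ∧ 0 < A)) := by
  have dqp := dist_comm q p
  have drq := dist_comm r q
  have drp := dist_comm r p
  have cpq : 0 < dist p q := by linarith
  have cqr : 0 < dist q r := by linarith
  have crp : 0 < dist r p := by linarith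
  obtain ⟨p', q', r', epq, eqr, epr⟩ := exists_comparison_triangle
    hnd₁.le (by linarith) (by linarith) cpq cqr.le (dist_nonneg (x := p) (y := r))
  have erp : dist r p = dist r' p' := by rw [dist_comm r' p', epr, drp]
  have compA := hpq.compAngle_eq_angle hrp epq.symm erp eqr.symm
  have compB := hqr.compAngle_eq_angle hpq eqr.symm epq.symm erp
  have compC := hrp.compAngle_eq_angle hqr erp eqr.symm epq.symm
  have leA := alexAngle_le_compAngle γpq (fun t => γrp (dist r p - t)) ⟨cpq, le_rfl⟩ ⟨crp, le_rfl⟩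
  have leB := alexAngle_le_compAngle γqr (fun t => γpq (dist p q - t)) ⟨cqr, le_rfl⟩ ⟨cpq, le_rfl⟩
  have leC := alexAngle_le_compAngle γrp (fun t => γqr (dist q r - t)) ⟨crp, le_rfl⟩ ⟨cqr, le_rfl⟩
  rw [← hA, compA] at leA
  rw [← hB, compB] at leB
  rw [← hC, compC] at leC
  have hne : p' ≠ q' := dist_pos.1 (epq.symm ▸ cpq)
  have hpi := EuclideanGeometry.angle_add_angle_add_angle_eq_pi r' hne
  have eqA : A = EuclideanGeometry.angle q' p' r' := by linarith
  have eqB : B = EuclideanGeometry.angle r' q' p' := by linarith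
  have eqC : C = EuclideanGeometry.angle p' r' q' := by linarith
  obtain ⟨f, hf⟩ := hX.exists_isometric_filling hpq hqr hrp epq.symm eqr.symm erp
    (fun s hs t ht => dist_comparison_le_of_angle_le_alexAngle hpq hrp cpq crp epq.symm erp
      eqr.symm (hA ▸ eqA.ge) hs ht)
    (fun s hs t ht => dist_comparison_le_of_angle_le_alexAngle hqr hpq cqr cpq eqr.symm epq.symm
      erp (hB ▸ eqB.ge) hs ht)
    (fun s hs t ht => dist_comparison_le_of_angle_le_alexAngle hrp hqr crp cqr erp eqr.symm
      epq.symm (hC ▸ eqC.ge) hs ht)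
  refine ⟨⟨p', q', r', f, hf⟩, by linarith, ?_⟩
  rintro (⟨h1, h2, h3⟩ | ⟨h1, h2, h3⟩ | ⟨h1, h2, h3⟩) <;> linarith
end
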